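/- Let n ≥ 2 and let A be an n-qubit architecture with R = T·L gates that is the concatenation of T consecutive causal slices of L gates each, where T ≤ 4^n − 1. Then for μ-almost every x ∈ SU(4)^{×R} (i.e., with unit probability over the random quantum circuit), the exact circuit complexity of the implemented unitary satisfies C_u(F^A(x)) ≥ R/(9L) − n/3. -/

import Mathlib

open scoped Matrix ENNReal Classical Kronecker ComplexOrder
open MeasureTheory

/-! ## Basic objects: qubit bases, gates, architectures, contraction maps -/

/-- Computational-basis index set for `n` qubits. -/
abbrev QubitBasis (n : ℕ) := Fin n → Fin 2

/-- `2^n × 2^n` complex matrices, indexed by the computational basis of `n` qubits. -/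
abbrev NMatrix (n : ℕ) := Matrix (QubitBasis n) (QubitBasis n) ℂ

/-- The special unitary group `SU(4)` of two-qubit gates. -/
abbrev SU4 := Matrix.specialUnitaryGroup (Fin 4) ℂ

/-- An architecture on `n` qubits with `R` gates: a list of ordered pairs of distinct qubits. -/
def Architecture (n R : ℕ) := Fin R → {p : Fin n × Fin n // p.1 ≠ p.2}

/-- Identification of a pair of one-qubit basis indices with a two-qubit basis index. -/
def pairIdx (a b : Fin 2) : Fin 4 := ⟨2 * a.val + b.val, by omega⟩

/-- The `n`-qubit matrix given by letting the two-qubit matrix `u` act on the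
tensor factors `p.1` and `p.2`, and as the identity on all other factors. -/
noncomputable def embedGate {n : ℕ} (p : Fin n × Fin n) (u : Matrix (Fin 4) (Fin 4) ℂ) :
    NMatrix n := fun a b =>
  if (∀ i, i ≠ p.1 → i ≠ p.2 → a i = b i)
  then u (pairIdx (a p.1) (a p.2)) (pairIdx (b p.1) (b p.2)) else 0

/-- The list of `n`-qubit gates obtained by substituting the gates `x` into
the architecture `A`. -/
noncomputable def gateList {n R : ℕ} (A : Architecture n R) (x : Fin R → SU4) :
    List (NMatrix n) :=
  List.ofFn fun i => embedGate (A i).1 (x i : Matrix (Fin 4) (Fin 4) ℂ)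

/-- The contraction map `F^A` of an architecture `A`: it sends a tuple of two-qubit gates
`(u_1, …, u_R)` to the `n`-qubit unitary `(u_R)_{p_R} ⋯ (u_1)_{p_1}`. -/
noncomputable def contract {n R : ℕ} (A : Architecture n R) (x : Fin R → SU4) : NMatrix n :=
  ((gateList A x).reverse).prod

/-- The exact circuit complexity: the least number `R` of two-qubit gates, arranged in any
architecture, implementing the matrix `U`. -/
noncomputable def Cu (n : ℕ) (U : NMatrix n) : ℕ :=
  sInf {R | ∃ A : Architecture n R, ∃ x : Fin R → SU4, contract A x = U}

/-- The all-zeros computational basis state `|0^n⟩`. -/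
noncomputable def ket0 (n : ℕ) : QubitBasis n → ℂ := fun a => if a = fun _ => 0 then 1 else 0

/-- The exact state complexity: the least number `R` of two-qubit gates, arranged in any
architecture, producing `ψ` from `|0^n⟩`. -/
noncomputable def Cstate (n : ℕ) (ψ : QubitBasis n → ℂ) : ℕ :=
  sInf {R | ∃ A : Architecture n R, ∃ x : Fin R → SU4, (contract A x) *ᵥ ket0 n = ψ}

/-- The gates with indices `lo ≤ i < hi` of `A` form a causal slice with sink qubit `t`:
every qubit `q` is connected to `t` by a path through gates of the slice, taken in
increasing index order. -/
def IsCausalSliceWith {n R : ℕ} (A : Architecture n R) (lo hi : ℕ) (t : Fin n) : Prop :=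
  ∀ q : Fin n, ∃ (m : ℕ) (idx : Fin m → Fin R) (qs : Fin (m + 1) → Fin n),
    StrictMono idx ∧ (∀ l, lo ≤ (idx l : ℕ) ∧ (idx l : ℕ) < hi) ∧
    qs 0 = q ∧ qs (Fin.last m) = t ∧
    ∀ l : Fin m,
      (qs l.castSucc = (A (idx l)).1.1 ∨ qs l.castSucc = (A (idx l)).1.2) ∧
      (qs l.succ = (A (idx l)).1.1 ∨ qs l.succ = (A (idx l)).1.2)

/-- The gates with indices `lo ≤ i < hi` of `A` form a causal slice. -/
def IsCausalSlice {n R : ℕ} (A : Architecture n R) (lo hi : ℕ) : Prop :=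
  ∃ t, IsCausalSliceWith A lo hi t

/-! ## Group, topological, measurable and compactness structure on `SU(4)`,
and its Haar probability measure -/

namespace SU4

theorem star_mem {U : Matrix (Fin 4) (Fin 4) ℂ}
    (hU : U ∈ Matrix.specialUnitaryGroup (Fin 4) ℂ) :
    star U ∈ Matrix.specialUnitaryGroup (Fin 4) ℂ := by
  rw [Matrix.mem_specialUnitaryGroup_iff] at hU ⊢
  refine ⟨Unitary.star_mem hU.1, ?_⟩
  have : (star U).det = star U.det := by
    simp [Matrix.star_eq_conjTranspose, Matrix.det_conjTranspose]
  rw [this, hU.2]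
  simp

noncomputable instance : Group SU4 :=
  { (inferInstance : Monoid SU4) with
    inv := fun U => ⟨star U.1, star_mem U.2⟩
    inv_mul_cancel := fun U => Subtype.ext <| by
      have h := (Matrix.mem_specialUnitaryGroup_iff.mp U.2).1.1
      simpa using h }

instance : IsTopologicalGroup SU4 where
  continuous_mul := by
    apply Continuous.subtype_mk
    exact ((continuous_subtype_val.comp continuous_fst).matrix_mul
      (continuous_subtype_val.comp continuous_snd))
  continuous_inv := by
    apply Continuous.subtype_mk
    exact continuous_star.comp continuous_subtype_val

noncomputable instance : MeasurableSpace (Matrix (Fin 4) (Fin 4) ℂ) :=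
  inferInstanceAs (MeasurableSpace (Fin 4 → Fin 4 → ℂ))

instance : BorelSpace (Matrix (Fin 4) (Fin 4) ℂ) :=
  inferInstanceAs (BorelSpace (Fin 4 → Fin 4 → ℂ))

theorem isClosed :
    IsClosed (Matrix.specialUnitaryGroup (Fin 4) ℂ : Set (Matrix (Fin 4) (Fin 4) ℂ)) := by
  have h1 : IsClosed {M : Matrix (Fin 4) (Fin 4) ℂ | star M * M = 1} :=
    isClosed_eq ((continuous_id.matrix_conjTranspose).matrix_mul continuous_id) continuous_const
  have h2 : IsClosed {M : Matrix (Fin 4) (Fin 4) ℂ | M * star M = 1} :=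
    isClosed_eq (continuous_id.matrix_mul (continuous_id.matrix_conjTranspose)) continuous_const
  have h3 : IsClosed {M : Matrix (Fin 4) (Fin 4) ℂ | M.det = 1} :=
    isClosed_eq continuous_id.matrix_det continuous_const
  have : (Matrix.specialUnitaryGroup (Fin 4) ℂ : Set (Matrix (Fin 4) (Fin 4) ℂ)) =
      ({M | star M * M = 1} ∩ {M | M * star M = 1}) ∩ {M | M.det = 1} := by
    ext M
    simp only [SetLike.mem_coe, Matrix.mem_specialUnitaryGroup_iff, Unitary.mem_iff,
      Set.mem_inter_iff, Set.mem_setOf_eq]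
  rw [this]
  exact ((h1.inter h2)).inter h3

theorem isCompact :
    IsCompact (Matrix.specialUnitaryGroup (Fin 4) ℂ : Set (Matrix (Fin 4) (Fin 4) ℂ)) := by
  have hK : IsCompact (Set.pi Set.univ fun _ : Fin 4 => Set.pi Set.univ fun _ : Fin 4 =>
      Metric.closedBall (0 : ℂ) 1 : Set (Matrix (Fin 4) (Fin 4) ℂ)) :=
    isCompact_univ_pi fun _ => isCompact_univ_pi fun _ => isCompact_closedBall _ _
  refine IsCompact.of_isClosed_subset hK isClosed ?_
  intro M hM
  refine fun i _ => fun j _ => ?_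
  simp only [Metric.mem_closedBall, dist_zero_right]
  exact entry_norm_bound_of_unitary (Matrix.mem_specialUnitaryGroup_iff.mp hM).1 i j

instance : CompactSpace SU4 :=
  isCompact_iff_compactSpace.mp isCompact

noncomputable instance : MeasurableSpace SU4 := borel SU4

instance : BorelSpace SU4 := ⟨rfl⟩

end SU4

/-- The Haar probability measure on `SU(4)`. -/
noncomputable def haarSU4 : Measure SU4 :=
  Measure.haarMeasure ⟨⟨Set.univ, isCompact_univ⟩, by simp⟩

instance : IsProbabilityMeasure haarSU4 := by
  constructor
  have h : Measure.haarMeasure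
      (⟨⟨Set.univ, isCompact_univ⟩, by simp⟩ : TopologicalSpace.PositiveCompacts SU4)
      (⟨⟨Set.univ, isCompact_univ⟩, by simp⟩ : TopologicalSpace.PositiveCompacts SU4) = 1 :=
    Measure.haarMeasure_self
  simpa [haarSU4] using h

/-- The product of Haar probability measures on `SU(4)^{×R}`: the distribution of a random
quantum circuit with `R` gates in a fixed architecture. -/
noncomputable def muSU4 (R : ℕ) : Measure (Fin R → SU4) :=
  Measure.pi fun _ => haarSU4

/-! ## The differential of the contraction map, its rank, and the accessible dimension -/

/-- The Lie algebra `su(m)` of traceless skew-Hermitian matrices, as a real subspace. -/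
noncomputable def suAlgebra (m : Type*) [Fintype m] [DecidableEq m] :
    Submodule ℝ (Matrix m m ℂ) :=
  Submodule.span ℝ {H | Hᴴ = -H ∧ H.trace = 0}

/-- `embedGate` as a real-linear map in the gate entry. -/
noncomputable def embedLin {n : ℕ} (p : Fin n × Fin n) :
    Matrix (Fin 4) (Fin 4) ℂ →ₗ[ℝ] NMatrix n where
  toFun := embedGate p
  map_add' u v := by
    funext a b
    simp only [embedGate, Matrix.add_apply]
    split <;> simp
  map_smul' r u := by
    funext a b
    simp only [embedGate, Matrix.smul_apply, RingHom.id_apply]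
    split <;> simp

/-- The differential of the contraction map `F^A` at the point `x ∈ SU(4)^{×R}`, read in the
exponential charts: the direction `(H_1, …, H_R)` is mapped to
`∑_j (U_R)_{p_R} ⋯ (U_{j+1})_{p_{j+1}} · (H_j)_{p_j} · (U_j)_{p_j} ⋯ (U_1)_{p_1}`. -/
noncomputable def contractDiff {n R : ℕ} (A : Architecture n R) (x : Fin R → SU4) :
    (Fin R → Matrix (Fin 4) (Fin 4) ℂ) →ₗ[ℝ] NMatrix n :=
  ∑ j : Fin R,
    (LinearMap.mulLeft ℝ (((gateList A x).drop (j + 1)).reverse.prod)) ∘ₗ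
      (LinearMap.mulRight ℝ
        (embedGate (A j).1 (x j : Matrix (Fin 4) (Fin 4) ℂ) *
          ((gateList A x).take j).reverse.prod)) ∘ₗ
      (embedLin (A j).1) ∘ₗ
      (LinearMap.proj j)

/-- The rank of (the differential of) the contraction map `F^A` at `x`: the dimension of
the image, under the differential, of the tangent space `su(4)^{×R}`. -/
noncomputable def rankAt {n R : ℕ} (A : Architecture n R) (x : Fin R → SU4) : ℕ :=
  Module.finrank ℝ
    ↥(Submodule.map (contractDiff A x) (Submodule.pi Set.univ fun _ => suAlgebra (Fin 4)))

/-- The maximal rank `r_max` of the contraction map `F^A` over all points of `SU(4)^{×R}`. -/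
noncomputable def rmax {n R : ℕ} (A : Architecture n R) : ℕ := ⨆ x, rankAt A x

/-- A matrix viewed as a point of the Euclidean (Frobenius) space of its entries. -/
noncomputable def toEuc {n : ℕ} (M : NMatrix n) :
    EuclideanSpace ℂ (QubitBasis n × QubitBasis n) := WithLp.toLp 2 fun p => M p.1 p.2

/-- The Frobenius norm `‖X‖_F = (tr (X† X))^{1/2}` of an `n`-qubit matrix. -/
noncomputable def frobNorm {n : ℕ} (M : NMatrix n) : ℝ := ‖toEuc M‖

/-- The accessible dimension `d_A` of an architecture `A`: the Hausdorff dimension of the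
set `U(A)` of unitaries implementable with `A`, with respect to the Frobenius metric. -/
noncomputable def accessibleDim {n R : ℕ} (A : Architecture n R) : ℝ≥0∞ :=
  dimH (toEuc '' Set.range (contract A))

/-! ## Pauli strings and Clifford gates -/

/-- The Pauli matrices `1, X, Y, Z`. -/
noncomputable def pauli : Fin 4 → Matrix (Fin 2) (Fin 2) ℂ
  | 0 => 1
  | 1 => !![0, 1; 1, 0]
  | 2 => !![0, -Complex.I; Complex.I, 0]
  | 3 => !![1, 0; 0, -1]

/-- The `n`-qubit Pauli string `⨂ᵢ pauli (s i)`. -/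
noncomputable def pauliString {n : ℕ} (s : Fin n → Fin 4) : NMatrix n :=
  fun a b => ∏ i, pauli (s i) (a i) (b i)

/-- A two-qubit Pauli string, as a `4 × 4` matrix. -/
noncomputable def pauli2 (s : Fin 2 → Fin 4) : Matrix (Fin 4) (Fin 4) ℂ :=
  fun a b =>
    pauli (s 0) ⟨a.val / 2, by have := a.isLt; omega⟩ ⟨b.val / 2, by have := b.isLt; omega⟩ *
    pauli (s 1) ⟨a.val % 2, by have := a.isLt; omega⟩ ⟨b.val % 2, by have := b.isLt; omega⟩

/-- A two-qubit gate is Clifford if it maps every Pauli string to a scalar multiple of a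
Pauli string under conjugation. -/
def IsCliffordGate (u : Matrix (Fin 4) (Fin 4) ℂ) : Prop :=
  ∀ s : Fin 2 → Fin 4, ∃ (c : ℂ) (s' : Fin 2 → Fin 4),
    u * pauli2 s * uᴴ = c • pauli2 s'

/-- Application to the state `|0^n⟩`, `M ↦ M |0^n⟩`, as a real-linear map. -/
noncomputable def mulVecKet0 (n : ℕ) : NMatrix n →ₗ[ℝ] (QubitBasis n → ℂ) where
  toFun M := M *ᵥ ket0 n
  map_add' M N := Matrix.add_mulVec M N (ket0 n)
  map_smul' r M := by
    simp only [RingHom.id_apply]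
    exact Matrix.smul_mulVec r M (ket0 n)

/-- The rank of (the differential of) the map `G^A : x ↦ F^A(x)|0^n⟩` at `x`. -/
noncomputable def stateRankAt {n R : ℕ} (A : Architecture n R) (x : Fin R → SU4) : ℕ :=
  Module.finrank ℝ
    ↥(Submodule.map ((mulVecKet0 n) ∘ₗ contractDiff A x)
      (Submodule.pi Set.univ fun _ => suAlgebra (Fin 4)))

/-! ## Trace norm and operator norm -/

/-- The positive semidefinite square root of a positive semidefinite matrix. -/
noncomputable def Matrix.PosSemidef.sqrt {m 𝕜 : Type*} [Fintype m] [RCLike 𝕜] [DecidableEq m]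
    {A : Matrix m m 𝕜} (hA : A.PosSemidef) : Matrix m m 𝕜 :=
  hA.1.eigenvectorUnitary.1 * Matrix.diagonal ((RCLike.ofReal : ℝ → 𝕜) ∘ Real.sqrt ∘ hA.1.eigenvalues) *
    (star hA.1.eigenvectorUnitary : Matrix m m 𝕜)

/-- The trace norm `‖M‖₁ = tr ((M† M)^{1/2})` of a square complex matrix. -/
noncomputable def traceNorm {m : Type*} [Fintype m] [DecidableEq m] (M : Matrix m m ℂ) : ℝ :=
  ((Matrix.posSemidef_conjTranspose_mul_self M).sqrt.trace).re

/-- The operator norm (largest singular value) of a square complex matrix: the norm of the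
induced operator between Euclidean spaces. -/
noncomputable def opNorm {m : Type*} [Fintype m] [DecidableEq m] (M : Matrix m m ℂ) : ℝ :=
  ‖LinearMap.toContinuousLinearMap (Matrix.toEuclideanLin M)‖

/-! ## The uniform measure on a finite index set -/

/-- The uniform probability measure on `Fin m`. -/
noncomputable def uniformFin (m : ℕ) : Measure (Fin m) :=
  ((m : ℝ≥0∞))⁻¹ • Measure.count

instance (m : ℕ) : IsFiniteMeasure (uniformFin m) := by
  constructor
  rw [uniformFin, Measure.smul_apply, smul_eq_mul, Measure.count_univ,
    ENat.card_eq_coe_fintype_card, Fintype.card_fin, ENat.toENNReal_coe]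
  rcases Nat.eq_zero_or_pos m with h | h
  · simp [h]
  · rw [ENNReal.inv_mul_cancel (by exact_mod_cast h.ne') (by simp)]
    exact ENNReal.one_lt_top

/-! ## Statement 0: linear growth of exact circuit complexity for random quantum circuits -/

/-! ## Tensor algebra -/

abbrev M2 := Matrix (Fin 2) (Fin 2) ℂ
abbrev M4 := Matrix (Fin 4) (Fin 4) ℂ

def hiB (i : Fin 4) : Fin 2 := ⟨i.val / 2, by omega⟩
def loB (i : Fin 4) : Fin 2 := ⟨i.val % 2, by omega⟩

def k2 (a b : M2) : M4 := fun i j => a (hiB i) (hiB j) * b (loB i) (loB j)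

def tens {n : ℕ} (g : Fin n → M2) : NMatrix n := fun a b => ∏ i, g i (a i) (b i)

lemma hiB_pair (a b : Fin 2) : hiB (pairIdx a b) = a := by
  apply Fin.ext; simp [hiB, pairIdx]; omega
lemma loB_pair (a b : Fin 2) : loB (pairIdx a b) = b := by
  apply Fin.ext; simp [loB, pairIdx]; omega
lemma pair_hilo (i : Fin 4) : pairIdx (hiB i) (loB i) = i := by
  apply Fin.ext; simp [loB, hiB, pairIdx]; omega

lemma tens_mul {n : ℕ} (g h : Fin n → M2) : tens g * tens h = tens (g * h) := by
  funext a b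
  simp only [Matrix.mul_apply, tens, Pi.mul_apply]
  rw [Finset.prod_univ_sum]
  simp [Fintype.piFinset_univ, Finset.prod_mul_distrib]

lemma tens_one {n : ℕ} : tens (1 : Fin n → M2) = 1 := by
  funext a b
  simp only [tens, Pi.one_apply, Matrix.one_apply]
  by_cases h : a = b
  · subst h; simp
  · rw [if_neg h]
    obtain ⟨i, hi⟩ := Function.ne_iff.mp h
    exact Finset.prod_eq_zero (Finset.mem_univ i) (by simp [hi])

/-- set sites `p.1`, `p.2` -/
def upd {n : ℕ} (p : Fin n × Fin n) (g : Fin n → M2) (a b : M2) : Fin n → M2 :=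
  fun i => if i = p.1 then a else if i = p.2 then b else g i

lemma embed_k2 {n : ℕ} {p : Fin n × Fin n} (hp : p.1 ≠ p.2) (a b : M2) :
    embedGate p (k2 a b) = tens (upd p 1 a b) := by
  funext x y
  have key : ∀ f : Fin n → ℂ, ∏ i, f i = f p.1 * (f p.2 * ∏ i ∈ (Finset.univ.erase p.1).erase p.2, f i) := by
    intro f
    rw [Finset.mul_prod_erase _ _ (by simp [hp.symm]), Finset.mul_prod_erase _ _ (by simp)]
  simp only [embedGate, k2, hiB_pair, loB_pair, tens]
  rw [key]
  simp only [upd, if_true, if_neg hp.symm]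
  split_ifs with h
  · rw [Finset.prod_eq_one]
    · ring
    · intro i hi
      simp only [Finset.mem_erase, Finset.mem_univ, and_true] at hi
      rw [if_neg hi.2, if_neg hi.1, h i hi.2 hi.1]; simp
  · push Not at h
    obtain ⟨i, h1, h2, h3⟩ := h
    rw [Finset.prod_eq_zero (i := i) (by simp [h1, h2])]
    · simp
    · simp [h1, h2, h3]

noncomputable def embC {n : ℕ} (p : Fin n × Fin n) : M4 →ₗ[ℂ] NMatrix n where
  toFun := embedGate p
  map_add' u v := by
    funext a b
    simp only [embedGate, Matrix.add_apply]
    split <;> simp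
  map_smul' r u := by
    funext a b
    simp only [embedGate, Matrix.smul_apply, RingHom.id_apply]
    split <;> simp

@[simp] lemma embC_apply {n : ℕ} (p : Fin n × Fin n) (u : M4) : embC p u = embedGate p u := rfl

lemma k2_single (i j : Fin 4) : (Matrix.single i j (1:ℂ) : M4) =
    k2 (Matrix.single (hiB i) (hiB j) 1) (Matrix.single (loB i) (loB j) 1) := by
  funext x y
  simp only [k2, Matrix.single_apply]
  have e : ∀ i x : Fin 4, (i = x) ↔ (hiB i = hiB x ∧ loB i = loB x) := by decide
  simp only [e i x, e j y]
  by_cases h1 : hiB i = hiB x <;> by_cases h2 : hiB j = hiB y <;>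
   by_cases h3 : loB i = loB x <;> by_cases h4 : loB j = loB y <;> simp [h1, h2, h3, h4]

lemma span_k2 : Submodule.span ℂ (Set.range fun q : M2 × M2 => k2 q.1 q.2) = ⊤ := by
  rw [eq_top_iff]
  rintro u -
  rw [Matrix.matrix_eq_sum_single u]
  refine Submodule.sum_mem _ fun i _ => Submodule.sum_mem _ fun j _ => ?_
  have : (Matrix.single i j (u i j) : M4) = u i j • Matrix.single i j 1 := by
    simp [Matrix.smul_single]
  rw [this, k2_single]
  exact Submodule.smul_mem _ _ (Submodule.subset_span ⟨(_, _), rfl⟩)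

/-- linear maps agreeing on product operators agree -/
lemma lin_ext_k2 {V : Type*} [AddCommGroup V] [Module ℂ V] {f g : M4 →ₗ[ℂ] V}
    (h : ∀ a b, f (k2 a b) = g (k2 a b)) (u : M4) : f u = g u := by
  have : f = g := LinearMap.ext_on_range (v := fun q : M2 × M2 => k2 q.1 q.2) span_k2
    (fun q => h q.1 q.2)
  rw [this]

lemma k2_mul (a b c d : M2) : k2 a b * k2 c d = k2 (a * c) (b * d) := by
  funext i j
  simp only [k2, Matrix.mul_apply, Fin.sum_univ_two, Fin.sum_univ_four]
  have h0 : hiB 0 = 0 := rfl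
  have h1 : hiB 1 = 0 := rfl
  have h2 : hiB 2 = 1 := rfl
  have h3 : hiB 3 = 1 := rfl
  have l0 : loB 0 = 0 := rfl
  have l1 : loB 1 = 1 := rfl
  have l2 : loB 2 = 0 := rfl
  have l3 : loB 3 = 1 := rfl
  rw [h0, h1, h2, h3, l0, l1, l2, l3]
  ring

lemma k2_one : k2 1 1 = 1 := by
  funext i j
  have e : ∀ i x : Fin 4, (i = x) ↔ (hiB i = hiB x ∧ loB i = loB x) := by decide
  simp only [k2, Matrix.one_apply, e i j]
  by_cases h1 : hiB i = hiB j <;> by_cases h2 : loB i = loB j <;> simp [h1, h2]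

lemma embed_k2_mul_tens {n : ℕ} {p : Fin n × Fin n} (hp : p.1 ≠ p.2) (a b : M2) (g : Fin n → M2) :
    embedGate p (k2 a b) * tens g = tens (upd p g (a * g p.1) (b * g p.2)) := by
  rw [embed_k2 hp, tens_mul]
  congr 1
  funext i
  simp only [upd, Pi.mul_apply]
  split_ifs with h1 h2
  · rw [h1]
  · rw [h2]
  · simp

lemma tens_mul_embed_k2 {n : ℕ} {p : Fin n × Fin n} (hp : p.1 ≠ p.2) (a b : M2) (g : Fin n → M2) :
    tens g * embedGate p (k2 a b) = tens (upd p g (g p.1 * a) (g p.2 * b)) := by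
  rw [embed_k2 hp, tens_mul]
  congr 1
  funext i
  simp only [upd, Pi.mul_apply]
  split_ifs with h1 h2
  · rw [h1]
  · rw [h2]
  · simp

lemma embed_one {n : ℕ} {p : Fin n × Fin n} (hp : p.1 ≠ p.2) : embedGate p (1 : M4) = 1 := by
  rw [← k2_one, embed_k2 hp, ← tens_one]
  congr 1
  funext i
  simp [upd]

lemma embed_mul {n : ℕ} {p : Fin n × Fin n} (hp : p.1 ≠ p.2) (u v : M4) :
    embedGate p (u * v) = embedGate p u * embedGate p v := by
  have h1 : ∀ a b : M2, ∀ v, embedGate p (k2 a b * v) = embedGate p (k2 a b) * embedGate p v := by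
    intro a b
    refine lin_ext_k2 (f := embC p ∘ₗ LinearMap.mulLeft ℂ (k2 a b))
      (g := LinearMap.mulLeft ℂ (embedGate p (k2 a b)) ∘ₗ embC p) ?_
    intro c d
    simp only [LinearMap.comp_apply, LinearMap.mulLeft_apply, embC_apply, k2_mul]
    rw [embed_k2 hp c d, embed_k2_mul_tens hp, embed_k2 hp]
    congr 1
    funext i
    simp only [upd]
    split_ifs <;> simp_all
  refine lin_ext_k2 (f := embC p ∘ₗ LinearMap.mulRight ℂ v)
      (g := LinearMap.mulRight ℂ (embedGate p v) ∘ₗ embC p) ?_ u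
  intro a b
  simpa using h1 a b v

/-- pulling a product operator through a gate -/
lemma tens_mul_embed {n : ℕ} {p : Fin n × Fin n} (hp : p.1 ≠ p.2) (g : Fin n → M2) (u : M4) :
    tens g * embedGate p u = embedGate p (k2 (g p.1) (g p.2) * u) * tens (upd p g 1 1) := by
  refine lin_ext_k2 (f := LinearMap.mulLeft ℂ (tens g) ∘ₗ embC p)
      (g := LinearMap.mulRight ℂ (tens (upd p g 1 1)) ∘ₗ embC p ∘ₗ
        LinearMap.mulLeft ℂ (k2 (g p.1) (g p.2))) ?_ u
  intro a b
  simp only [LinearMap.comp_apply, LinearMap.mulLeft_apply, LinearMap.mulRight_apply, embC_apply,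
    k2_mul]
  rw [tens_mul_embed_k2 hp, embed_k2_mul_tens hp]
  congr 1
  funext i
  simp only [upd]
  split_ifs <;> simp_all

lemma tens_eq_embed {n : ℕ} {p : Fin n × Fin n} (hp : p.1 ≠ p.2) (g : Fin n → M2) :
    tens g = embedGate p (k2 (g p.1) (g p.2)) * tens (upd p g 1 1) := by
  have := tens_mul_embed hp g 1
  rwa [embed_one hp, mul_one, mul_one] at this

/-- conjugating a product operator by a gate -/
lemma embed_conj {n : ℕ} {p : Fin n × Fin n} (hp : p.1 ≠ p.2) (g : Fin n → M2) (u : M4)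
    (a b : M2) (h : u * k2 (g p.1) (g p.2) = k2 a b * u) :
    embedGate p u * tens g = tens (upd p g a b) * embedGate p u := by
  rw [tens_mul_embed hp, tens_eq_embed hp g, ← mul_assoc, ← embed_mul hp, h]
  have h1 : upd p g a b p.1 = a := by simp [upd]
  have h2 : upd p g a b p.2 = b := by simp [upd, hp.symm]
  have h3 : upd p (upd p g a b) 1 1 = upd p g 1 1 := by
    funext i; simp only [upd]; split_ifs <;> rfl
  rw [h1, h2, h3]

/-! Pauli strings span -/

lemma m2_pauli (a : M2) : ∃ c : Fin 4 → ℂ, ∀ i j, a i j = ∑ k, c k * pauli k i j := by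
  refine ⟨![(a 0 0 + a 1 1)/2, (a 0 1 + a 1 0)/2, (a 0 1 - a 1 0) * Complex.I / 2,
    (a 0 0 - a 1 1)/2], ?_⟩
  intro i j
  fin_cases i <;> fin_cases j <;> simp [Fin.sum_univ_four, pauli] <;> ring_nf <;> simp <;> ring

lemma tens_mem_span {n : ℕ} (g : Fin n → M2) :
    tens g ∈ Submodule.span ℂ (Set.range (pauliString (n := n))) := by
  choose c hc using fun i => m2_pauli (g i)
  have : tens g = ∑ s : Fin n → Fin 4, (∏ i, c i (s i)) • pauliString s := by
    funext a b
    simp only [tens, hc, Matrix.sum_apply, Matrix.smul_apply, pauliString, smul_eq_mul,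
      ← Finset.prod_mul_distrib]
    rw [Finset.prod_univ_sum, Fintype.piFinset_univ]
  rw [this]
  exact Submodule.sum_mem _ fun s _ => Submodule.smul_mem _ _ (Submodule.subset_span ⟨s, rfl⟩)

lemma span_pauli (n : ℕ) : Submodule.span ℂ (Set.range (pauliString (n := n))) = ⊤ := by
  rw [eq_top_iff]
  rintro u -
  rw [Matrix.matrix_eq_sum_single u]
  refine Submodule.sum_mem _ fun x _ => Submodule.sum_mem _ fun y _ => ?_
  have : (Matrix.single x y (u x y) : NMatrix n) =
      u x y • tens (fun i => Matrix.single (x i) (y i) 1) := by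
    funext a b
    simp only [Matrix.single_apply, tens, Matrix.smul_apply, smul_eq_mul]
    split_ifs with h
    · rw [Finset.prod_eq_one]
      · simp
      · intro i _; simp [h.1, h.2]
    · have : ∃ i, ¬ (x i = a i ∧ y i = b i) := by
        by_contra! hh
        exact h ⟨funext fun i => (hh i).1, funext fun i => (hh i).2⟩
      obtain ⟨i, hi⟩ := this
      rw [Finset.prod_eq_zero (Finset.mem_univ i)]
      · simp
      · rw [if_neg hi]
  rw [this]
  exact Submodule.smul_mem _ _ (tens_mem_span _)

lemma pauliString_eq {n : ℕ} (s : Fin n → Fin 4) : pauliString s = tens (fun i => pauli (s i)) := rfl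

lemma pauliString_zero {n : ℕ} : pauliString (fun _ : Fin n => (0 : Fin 4)) = 1 := by
  rw [pauliString_eq, ← tens_one]; rfl

/-! ## Moving Pauli operators with two-qubit gates -/

lemma su_phase (u : M4) (hu : u ∈ Matrix.unitaryGroup (Fin 4) ℂ) :
    ∃ ζ : ℂ, ζ ≠ 0 ∧ ζ • u ∈ Matrix.specialUnitaryGroup (Fin 4) ℂ := by
  have hd : u.det ∈ unitary ℂ := Matrix.det_of_mem_unitary hu
  have hd1 : ‖u.det‖ = 1 := by
    have := (Unitary.mem_iff.mp hd).1
    have h2 : ‖star u.det * u.det‖ = 1 := by rw [this]; simp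
    rw [norm_mul, norm_star] at h2
    nlinarith [norm_nonneg u.det]
  obtain ⟨ζ, hζ⟩ := IsAlgClosed.exists_pow_nat_eq (u.det)⁻¹ (n := 4) (by norm_num)
  have hdne : u.det ≠ 0 := by intro h; simp [h] at hd1
  have hn : ‖ζ‖ = 1 := by
    have : ‖ζ‖ ^ 4 = 1 := by rw [← norm_pow, hζ, norm_inv, hd1, inv_one]
    exact (pow_eq_one_iff_of_nonneg (norm_nonneg _) (by norm_num)).mp this
  refine ⟨ζ, by intro h; simp [h] at hn, ?_⟩
  rw [Matrix.mem_specialUnitaryGroup_iff]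
  constructor
  · rw [Matrix.mem_unitaryGroup_iff] at hu ⊢
    rw [star_smul, smul_mul_smul_comm, hu]
    have : ζ * star ζ = 1 := by
      have := Complex.mul_conj ζ
      rw [Complex.star_def, this, Complex.normSq_eq_norm_sq, hn]; simp
    rw [this, one_smul]
  · rw [Matrix.det_smul, Fintype.card_fin, hζ, inv_mul_cancel₀ hdne]

def CJ (M N : M4) : Prop := ∃ u : SU4, u.1 * M = N * u.1

lemma CJ.trans {M N K : M4} (h1 : CJ M N) (h2 : CJ N K) : CJ M K := by
  obtain ⟨u, hu⟩ := h1
  obtain ⟨v, hv⟩ := h2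
  refine ⟨v * u, ?_⟩
  rw [Submonoid.coe_mul, mul_assoc, hu, ← mul_assoc, hv, mul_assoc]

lemma CJ_of_anti {M N : M4} (hM : Mᴴ = M) (hN : Nᴴ = N) (hM2 : M * M = 1) (hN2 : N * N = 1)
    (h : M * N = - (N * M)) : CJ M N := by
  obtain ⟨r, hr⟩ : ∃ r : ℂ, r = (((Real.sqrt 2)⁻¹ : ℝ) : ℂ) := ⟨_, rfl⟩
  have hrr : r * r = 1 / 2 := by
    rw [hr, ← Complex.ofReal_mul, ← mul_inv, Real.mul_self_sqrt (by norm_num)]; simp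
  have hu : r • (M + N) ∈ Matrix.unitaryGroup (Fin 4) ℂ := by
    rw [Matrix.mem_unitaryGroup_iff, star_smul, Matrix.star_eq_conjTranspose,
      Matrix.conjTranspose_add, hM, hN, smul_mul_smul_comm]
    have hs : star r = r := by rw [hr]; exact Complex.conj_ofReal _
    have : (M + N) * (M + N) = (2 : ℂ) • (1 : M4) := by
      rw [add_mul, mul_add, mul_add, hM2, hN2, h, two_smul]; abel
    rw [hs, hrr, this, smul_smul]; norm_num
  obtain ⟨ζ, h0, hζ⟩ := su_phase _ hu
  refine ⟨⟨_, hζ⟩, ?_⟩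
  simp only [smul_mul_assoc, mul_smul_comm, add_mul, mul_add, hM2, hN2]
  rw [add_comm]

lemma pauli_herm (k : Fin 4) : (pauli k)ᴴ = pauli k := by
  fin_cases k <;> ext i j <;> fin_cases i <;> fin_cases j <;> simp [pauli]
lemma pauli_sq (k : Fin 4) : pauli k * pauli k = 1 := by
  fin_cases k <;> ext i j <;> fin_cases i <;> fin_cases j <;> simp [pauli]
lemma pauli_anti (k l : Fin 4) (hk : k ≠ 0) (hl : l ≠ 0) (h : k ≠ l) :
    pauli k * pauli l = - (pauli l * pauli k) := by
  fin_cases k <;> fin_cases l <;> simp_all <;> ext i j <;> fin_cases i <;> fin_cases j <;>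
    simp [pauli]
lemma pauli_zero : pauli 0 = 1 := rfl

lemma k2_herm (a b : M2) : (k2 a b)ᴴ = k2 aᴴ bᴴ := by
  funext i j; simp [k2, Matrix.conjTranspose_apply]
lemma k2_neg_left (a b : M2) : k2 (-a) b = - k2 a b := by
  funext i j; simp [k2]
lemma k2_neg_right (a b : M2) : k2 a (-b) = - k2 a b := by
  funext i j; simp [k2]

noncomputable def kp (a b : Fin 4) : M4 := k2 (pauli a) (pauli b)

lemma kp_anti_left (a a' b b' : Fin 4) (h : pauli a * pauli a' = -(pauli a' * pauli a))
    (h' : pauli b * pauli b' = pauli b' * pauli b) : CJ (kp a b) (kp a' b') := by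
  apply CJ_of_anti
  · simp [kp, k2_herm, pauli_herm]
  · simp [kp, k2_herm, pauli_herm]
  · simp [kp, k2_mul, pauli_sq, k2_one]
  · simp [kp, k2_mul, pauli_sq, k2_one]
  · simp only [kp, k2_mul, h, h', k2_neg_left]

lemma kp_anti_right (a a' b b' : Fin 4) (h : pauli b * pauli b' = -(pauli b' * pauli b))
    (h' : pauli a * pauli a' = pauli a' * pauli a) : CJ (kp a b) (kp a' b') := by
  apply CJ_of_anti
  · simp [kp, k2_herm, pauli_herm]
  · simp [kp, k2_herm, pauli_herm]
  · simp [kp, k2_mul, pauli_sq, k2_one]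
  · simp [kp, k2_mul, pauli_sq, k2_one]
  · simp only [kp, k2_mul, h, h', k2_neg_right]

lemma exists_third (b : Fin 4) : ∃ c : Fin 4, c ≠ 0 ∧ c ≠ b := by
  revert b; decide

lemma move_right (a b : Fin 4) (h : ¬ (a = 0 ∧ b = 0)) : ∃ c, c ≠ 0 ∧ CJ (kp a b) (kp 0 c) := by
  by_cases hb : b = 0
  · subst hb
    have ha : a ≠ 0 := fun h' => h ⟨h', rfl⟩
    obtain ⟨a', h1, h2⟩ := exists_third a
    refine ⟨2, by decide, CJ.trans (kp_anti_left a a' 0 1 (pauli_anti _ _ ha h1 h2.symm) ?_)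
      (kp_anti_right a' 0 1 2 (pauli_anti _ _ (by decide) (by decide) (by decide)) ?_)⟩
    · simp [pauli_zero]
    · simp [pauli_zero]
  · obtain ⟨c, h1, h2⟩ := exists_third b
    exact ⟨c, h1, kp_anti_right _ _ _ _ (pauli_anti _ _ hb h1 h2.symm) (by simp [pauli_zero])⟩

lemma move_left (a b : Fin 4) (h : ¬ (a = 0 ∧ b = 0)) : ∃ c, c ≠ 0 ∧ CJ (kp a b) (kp c 0) := by
  by_cases hb : a = 0
  · subst hb
    have ha : b ≠ 0 := fun h' => h ⟨rfl, h'⟩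
    obtain ⟨a', h1, h2⟩ := exists_third b
    refine ⟨2, by decide, CJ.trans (kp_anti_right 0 1 b a' (pauli_anti _ _ ha h1 h2.symm) ?_)
      (kp_anti_left 1 2 a' 0 (pauli_anti _ _ (by decide) (by decide) (by decide)) ?_)⟩
    · simp [pauli_zero]
    · simp [pauli_zero]
  · obtain ⟨c, h1, h2⟩ := exists_third a
    exact ⟨c, h1, kp_anti_left _ _ _ _ (pauli_anti _ _ hb h1 h2.symm) (by simp [pauli_zero])⟩

/-- set two Pauli labels -/
def updS {n : ℕ} (p : Fin n × Fin n) (s : Fin n → Fin 4) (a b : Fin 4) : Fin n → Fin 4 :=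
  fun i => if i = p.1 then a else if i = p.2 then b else s i

/-- a Pauli string active on the pair `p` can be moved so that only `e` stays active in `p` -/
lemma pauli_move {n : ℕ} {p : Fin n × Fin n} (hp : p.1 ≠ p.2) (s : Fin n → Fin 4)
    (h : ¬ (s p.1 = 0 ∧ s p.2 = 0)) (e : Fin n) (he : e = p.1 ∨ e = p.2) :
    ∃ (u : SU4) (s' : Fin n → Fin 4),
      embedGate p u.1 * pauliString s = pauliString s' * embedGate p u.1 ∧
      (∀ q, s' q ≠ 0 → q = e ∨ (q ≠ p.1 ∧ q ≠ p.2 ∧ s q ≠ 0)) := by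
  have main : ∀ a b : Fin 4, CJ (kp (s p.1) (s p.2)) (kp a b) → ∃ u : SU4,
      embedGate p u.1 * pauliString s = pauliString (updS p s a b) * embedGate p u.1 := by
    rintro a b ⟨u, hu⟩
    refine ⟨u, ?_⟩
    have h1 := embed_conj hp (fun i => pauli (s i)) u.1 (pauli a) (pauli b) hu
    have h2 : upd p (fun i => pauli (s i)) (pauli a) (pauli b) =
        fun i => pauli (updS p s a b i) := by
      funext i
      simp only [upd, updS]
      split_ifs <;> rfl
    rw [h2] at h1
    exact h1
  rcases he with rfl | rfl
  · obtain ⟨c, -, hc⟩ := move_left _ _ h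
    obtain ⟨u, hu⟩ := main _ _ hc
    refine ⟨u, _, hu, ?_⟩
    intro q hq
    simp only [updS] at hq
    split_ifs at hq with h1 h2
    · exact Or.inl h1
    · exact absurd rfl hq
    · exact Or.inr ⟨h1, h2, hq⟩
  · obtain ⟨c, -, hc⟩ := move_right _ _ h
    obtain ⟨u, hu⟩ := main _ _ hc
    refine ⟨u, _, hu, ?_⟩
    intro q hq
    simp only [updS] at hq
    split_ifs at hq with h1 h2
    · exact absurd rfl hq
    · exact Or.inl h2
    · exact Or.inr ⟨h1, h2, hq⟩

/-! ## Tangent spaces along a circuit -/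

noncomputable def GG {n R : ℕ} (A : Architecture n R) (x : Fin R → M4) (k : ℕ) : NMatrix n :=
  if h : k < R then embedGate (A ⟨k, h⟩).1 (x ⟨k, h⟩) else 1

noncomputable def Phi {n R : ℕ} (A : Architecture n R) (x : Fin R → M4) : ℕ → NMatrix n
  | 0 => 1
  | k + 1 => GG A x k * Phi A x k

noncomputable def cl {R : ℕ} (x : Fin R → SU4) : Fin R → M4 := fun i => (x i).1

noncomputable def hh {n R : ℕ} (A : Architecture n R) (k : ℕ) : Submodule ℂ (NMatrix n) :=
  if h : k < R then LinearMap.range (embC (A ⟨k, h⟩).1) else ⊥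

noncomputable def cj {n : ℕ} (g g' : NMatrix n) : NMatrix n →ₗ[ℂ] NMatrix n :=
  LinearMap.mulLeft ℂ g ∘ₗ LinearMap.mulRight ℂ g'

noncomputable def Sv {n R : ℕ} (A : Architecture n R) (x : Fin R → SU4) :
    ℕ → Submodule ℂ (NMatrix n)
  | 0 => Submodule.span ℂ {1}
  | k + 1 => (Sv A x k).map (cj (GG A (cl x) k) (GG A (cl (x⁻¹)) k)) ⊔ hh A k

lemma su_inv_val (u : SU4) : (u⁻¹).1 * u.1 = 1 := by
  rw [← Submonoid.coe_mul, inv_mul_cancel]; rfl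
lemma su_val_inv (u : SU4) : u.1 * (u⁻¹).1 = 1 := by
  rw [← Submonoid.coe_mul, mul_inv_cancel]; rfl

lemma GG_inv_mul {n R : ℕ} (A : Architecture n R) (x : Fin R → SU4) (k : ℕ) :
    GG A (cl (x⁻¹)) k * GG A (cl x) k = 1 := by
  unfold GG
  split_ifs with h
  · rw [← embed_mul (A ⟨k, h⟩).2]
    simp only [cl, Pi.inv_apply]
    rw [su_inv_val, embed_one (A ⟨k, h⟩).2]
  · simp

lemma GG_mul_inv {n R : ℕ} (A : Architecture n R) (x : Fin R → SU4) (k : ℕ) :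
    GG A (cl x) k * GG A (cl (x⁻¹)) k = 1 := by
  have := GG_inv_mul A (x⁻¹) k
  rwa [inv_inv] at this

lemma cj_inj {n R : ℕ} (A : Architecture n R) (x : Fin R → SU4) (k : ℕ) :
    Function.Injective (cj (GG A (cl x) k) (GG A (cl (x⁻¹)) k)) := by
  intro M N h
  simp only [cj, LinearMap.comp_apply, LinearMap.mulLeft_apply, LinearMap.mulRight_apply] at h
  have h2 := congrArg (fun K => GG A (cl (x⁻¹)) k * K * GG A (cl x) k) h
  simp only [← mul_assoc, GG_inv_mul, one_mul] at h2
  simpa only [mul_assoc, GG_inv_mul, mul_one] using h2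

lemma finrank_map_cj {n R : ℕ} (A : Architecture n R) (x : Fin R → SU4) (k : ℕ)
    (S : Submodule ℂ (NMatrix n)) :
    Module.finrank ℂ (S.map (cj (GG A (cl x) k) (GG A (cl (x⁻¹)) k))) = Module.finrank ℂ S :=
  (LinearEquiv.finrank_eq (Submodule.equivMapOfInjective _ (cj_inj A x k) S)).symm

lemma Sv_mono {n R : ℕ} (A : Architecture n R) (x : Fin R → SU4) (k : ℕ) :
    Module.finrank ℂ (Sv A x k) ≤ Module.finrank ℂ (Sv A x (k + 1)) := by
  rw [← finrank_map_cj A x k]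
  exact Submodule.finrank_mono le_sup_left

lemma Sv_mono' {n R : ℕ} (A : Architecture n R) (x : Fin R → SU4) {k l : ℕ} (h : k ≤ l) :
    Module.finrank ℂ (Sv A x k) ≤ Module.finrank ℂ (Sv A x l) :=
  monotone_nat_of_le_succ (f := fun k => Module.finrank ℂ (Sv A x k)) (Sv_mono A x) h

lemma one_mem_Sv {n R : ℕ} (A : Architecture n R) (x : Fin R → SU4) (k : ℕ) : 1 ∈ Sv A x k := by
  induction k with
  | zero => exact Submodule.mem_span_singleton_self 1
  | succ k ih =>
    refine Submodule.mem_sup_left ⟨1, ih, ?_⟩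
    simp [cj, GG_mul_inv]

lemma GG_congr {n R : ℕ} (A : Architecture n R) {x y : Fin R → M4} {k : ℕ}
    (h : ∀ j : Fin R, j.1 = k → x j = y j) : GG A x k = GG A y k := by
  unfold GG
  split_ifs with hk
  · rw [h _ rfl]
  · rfl

lemma Sv_congr {n R : ℕ} (A : Architecture n R) {x y : Fin R → SU4} {k : ℕ}
    (h : ∀ j : Fin R, j.1 < k → x j = y j) : Sv A x k = Sv A y k := by
  induction k with
  | zero => rfl
  | succ k ih =>
    simp only [Sv]
    rw [ih (fun j hj => h j (by omega)), GG_congr A (x := cl x) (y := cl y),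
      GG_congr A (x := cl (x⁻¹)) (y := cl (y⁻¹))]
    · intro j hj; simp [cl, h j (by omega)]
    · intro j hj; simp [cl, h j (by omega)]

lemma Phi_congr {n R : ℕ} (A : Architecture n R) {x y : Fin R → M4} {k : ℕ}
    (h : ∀ j : Fin R, j.1 < k → x j = y j) : Phi A x k = Phi A y k := by
  induction k with
  | zero => rfl
  | succ k ih =>
    simp only [Phi]
    rw [ih (fun j hj => h j (by omega)), GG_congr A (x := x) (y := y)]
    intro j hj; exact h j (by omega)

def tch {n R : ℕ} (A : Architecture n R) (k : ℕ) (q : Fin n) : Prop :=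
  ∃ h : k < R, q = (A ⟨k, h⟩).1.1 ∨ q = (A ⟨k, h⟩).1.2

inductive Rch {n R : ℕ} (A : Architecture n R) (hi : ℕ) (t : Fin n) : ℕ → Fin n → Prop
  | base : Rch A hi t hi t
  | stay {k : ℕ} {q : Fin n} : Rch A hi t (k + 1) q → Rch A hi t k q
  | hop {k : ℕ} {q e : Fin n} : tch A k q → tch A k e → Rch A hi t (k + 1) e → Rch A hi t k q

lemma Rch.le {n R : ℕ} {A : Architecture n R} {hi k : ℕ} {t q : Fin n} (h : Rch A hi t k q) :
    k ≤ hi := by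
  induction h <;> omega

lemma Rch.end {n R : ℕ} {A : Architecture n R} {hi : ℕ} {t q : Fin n} (h : Rch A hi t hi q) :
    q = t := by
  cases h with
  | base => rfl
  | stay h => have := h.le; omega
  | hop _ _ h => have := h.le; omega

lemma Rch.down {n R : ℕ} {A : Architecture n R} {hi k l : ℕ} {t q : Fin n} (hkl : k ≤ l)
    (h : Rch A hi t l q) : Rch A hi t k q := by
  induction l, hkl using Nat.le_induction with
  | base => exact h
  | succ l _ ih => exact ih h.stay

lemma Rch.touch {n R : ℕ} {A : Architecture n R} {hi k : ℕ} {t q : Fin n} (h : Rch A hi t k q)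
    (hq : q ≠ t) : ∃ j, k ≤ j ∧ j < hi ∧ tch A j t := by
  induction h with
  | base => exact absurd rfl hq
  | stay h ih =>
    obtain ⟨j, h1, h2, h3⟩ := ih hq
    exact ⟨j, by omega, h2, h3⟩
  | @hop k q e h1 h2 h ih =>
    by_cases he : e = t
    · subst he
      exact ⟨k, le_rfl, h.le, h2⟩
    · obtain ⟨j, h1, h2, h3⟩ := ih he
      exact ⟨j, by omega, h2, h3⟩

lemma Rch.of_path {n R : ℕ} {A : Architecture n R} {hi : ℕ} {t : Fin n} (m : ℕ) :
    ∀ (k : ℕ) (idx : Fin m → Fin R) (qs : Fin (m + 1) → Fin n), k ≤ hi →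
    StrictMono idx → (∀ l, k ≤ (idx l : ℕ) ∧ (idx l : ℕ) < hi) →
    qs (Fin.last m) = t →
    (∀ l : Fin m,
      (qs l.castSucc = (A (idx l)).1.1 ∨ qs l.castSucc = (A (idx l)).1.2) ∧
      (qs l.succ = (A (idx l)).1.1 ∨ qs l.succ = (A (idx l)).1.2)) → Rch A hi t k (qs 0) := by
  induction m with
  | zero =>
    intro k idx qs hk _ _ ht _
    have : qs 0 = t := ht
    rw [this]
    exact Rch.base.down hk
  | succ m ih =>
    intro k idx qs hk hm hb ht hp
    have h0 := hb 0
    have := ih ((idx 0).1 + 1) (fun l => idx l.succ) (fun l => qs l.succ) (by omega)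
      (fun a b hab => hm (Fin.succ_lt_succ_iff.mpr hab))
      (fun l => ⟨Fin.lt_def.mp (hm (Fin.succ_pos l)), (hb l.succ).2⟩) ht
      (fun l => hp l.succ)
    have h1 : Rch A hi t (idx 0).1 (qs 0) := by
      refine Rch.hop (e := qs 1) ⟨(idx 0).2, (hp 0).1⟩ ⟨(idx 0).2, (hp 0).2⟩ this
    exact h1.down h0.1

lemma pauli_mem_hh {n R : ℕ} {A : Architecture n R} {k : ℕ} {t : Fin n} (ht : tch A k t)
    (s : Fin n → Fin 4) (hs : ∀ q, s q ≠ 0 → q = t) : pauliString s ∈ hh A k := by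
  obtain ⟨hk, ht⟩ := ht
  have hp := (A ⟨k, hk⟩).2
  unfold hh
  rw [dif_pos hk, pauliString_eq, tens_eq_embed hp]
  have : upd (A ⟨k, hk⟩).1 (fun i => pauli (s i)) 1 1 = 1 := by
    funext i
    simp only [upd, Pi.one_apply]
    split_ifs with h1 h2
    · rfl
    · rfl
    · have : s i = 0 := by
        by_contra hh
        have := hs i hh
        subst this
        rcases ht with h | h
        · exact h1 h
        · exact h2 h
      rw [this, pauli_zero]
  rw [this, tens_one, mul_one]
  exact ⟨_, rfl⟩

lemma slice_grow {n R : ℕ} (A : Architecture n R) (hi : ℕ) (hhi : hi ≤ R) (t : Fin n) (d : ℕ) :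
    ∀ (k : ℕ), k + d = hi → ∀ (x : Fin R → SU4) (s : Fin n → Fin 4),
    pauliString s ∉ Sv A x k → (∀ q, s q ≠ 0 → Rch A hi t k q) →
    ((∃ j, k ≤ j ∧ j < hi ∧ tch A j t) ∨
      ∀ s' : Fin n → Fin 4, (∀ q, s' q ≠ 0 → q = t) → pauliString s' ∈ Sv A x k) →
    ∃ x' : Fin R → SU4, Module.finrank ℂ (Sv A x k) + 1 ≤ Module.finrank ℂ (Sv A x' hi) := by
  induction d with
  | zero =>
    intro k hk x s hs hr ht
    exfalso
    have hk' : k = hi := by omega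
    subst hk'
    rcases ht with ⟨j, h1, h2, -⟩ | ht
    · omega
    · exact hs (ht s fun q hq => (hr q hq).end)
  | succ d ih =>
    intro k hk x s hs hr ht
    have hkR : k < R := by omega
    set p := (A ⟨k, hkR⟩) with hpdef
    obtain ⟨u, s', hu, hs'⟩ : ∃ (u : SU4) (s' : Fin n → Fin 4),
        embedGate p.1 u.1 * pauliString s = pauliString s' * embedGate p.1 u.1 ∧
        ∀ q, s' q ≠ 0 → Rch A hi t (k + 1) q := by
      have hstay : ∀ q, s q ≠ 0 → q ≠ p.1.1 → q ≠ p.1.2 → Rch A hi t (k + 1) q := by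
        intro q hq h1 h2
        cases hr q hq with
        | base => omega
        | stay h => exact h
        | hop h _ _ =>
          obtain ⟨_, h⟩ := h
          rcases h with h | h
          · exact absurd h h1
          · exact absurd h h2
      by_cases h0 : s p.1.1 = 0 ∧ s p.1.2 = 0
      · refine ⟨1, s, ?_, ?_⟩
        · have : ((1 : SU4) : M4) = 1 := rfl
          rw [this, embed_one p.2, one_mul, mul_one]
        · intro q hq
          refine hstay q hq ?_ ?_
          · rintro rfl; exact hq h0.1
          · rintro rfl; exact hq h0.2
      · obtain ⟨e, he, hre⟩ : ∃ e, (e = p.1.1 ∨ e = p.1.2) ∧ Rch A hi t (k + 1) e := by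
          obtain ⟨q, hqp, hq⟩ : ∃ q, (q = p.1.1 ∨ q = p.1.2) ∧ s q ≠ 0 := by
            by_contra! hc
            exact h0 ⟨hc _ (Or.inl rfl), hc _ (Or.inr rfl)⟩
          cases hr q hq with
          | base => omega
          | stay h => exact ⟨q, hqp, h⟩
          | hop _ h h' =>
            obtain ⟨_, h⟩ := h
            exact ⟨_, h, h'⟩
        obtain ⟨u, s', h1, h2⟩ := pauli_move p.2 s h0 e he
        refine ⟨u, s', h1, ?_⟩
        intro q hq
        rcases h2 q hq with rfl | ⟨h3, h4, h5⟩
        · exact hre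
        · exact hstay q h5 h3 h4
    set x1 : Fin R → SU4 := Function.update x ⟨k, hkR⟩ u with hx1
    have hSk : Sv A x1 k = Sv A x k := by
      apply Sv_congr
      intro j hj
      rw [hx1, Function.update_of_ne]
      intro h; rw [h] at hj; simp at hj
    have hG : GG A (cl x1) k = embedGate p.1 u.1 := by
      simp [GG, hkR, cl, hx1, hpdef]
    have hcj : cj (GG A (cl x1) k) (GG A (cl (x1⁻¹)) k) (pauliString s) = pauliString s' := by
      simp only [cj, LinearMap.comp_apply, LinearMap.mulLeft_apply, LinearMap.mulRight_apply]
      rw [← mul_assoc, hG, hu, mul_assoc, ← hG, GG_mul_inv, mul_one]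
    have hnot : pauliString s' ∉ (Sv A x1 k).map (cj (GG A (cl x1) k) (GG A (cl (x1⁻¹)) k)) := by
      rintro ⟨M, hM, hM'⟩
      rw [← hcj] at hM'
      have := cj_inj A x1 k hM'
      subst this
      rw [hSk] at hM
      exact hs hM
    by_cases hmem : pauliString s' ∈ Sv A x1 (k + 1)
    · refine ⟨x1, le_trans ?_ (Sv_mono' A x1 (show k + 1 ≤ hi by omega))⟩
      rw [← hSk, ← finrank_map_cj A x1 k]
      refine Submodule.finrank_lt_finrank_of_lt (lt_of_le_of_ne le_sup_left ?_)
      intro h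
      rw [h] at hnot
      exact hnot hmem
    · obtain ⟨x', hx'⟩ := ih (k + 1) (by omega) x1 s' hmem hs' (by
        by_cases htk : tch A k t
        · right
          intro s'' h''
          exact Submodule.mem_sup_right (pauli_mem_hh htk s'' h'')
        · rcases ht with ⟨j, h1, h2, h3⟩ | ht
          · left
            refine ⟨j, ?_, h2, h3⟩
            rcases Nat.lt_or_ge k j with h | h
            · exact h
            · have : j = k := by omega
              subst this; exact absurd h3 htk
          · right
            intro s'' h''
            refine Submodule.mem_sup_left ⟨pauliString s'', by rw [hSk]; exact ht s'' h'', ?_⟩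
            simp only [cj, LinearMap.comp_apply, LinearMap.mulLeft_apply, LinearMap.mulRight_apply]
            have hz : ∀ q, (q = p.1.1 ∨ q = p.1.2) → s'' q = 0 := by
              intro q hq
              by_contra hne
              have := h'' q hne
              subst this
              exact htk ⟨hkR, hq⟩
            have hc := embed_conj p.2 (fun i => pauli (s'' i)) u.1 1 1 (by
              simp only [hz _ (Or.inl rfl), hz _ (Or.inr rfl), pauli_zero, k2_one, one_mul,
                mul_one])
            have hup : upd p.1 (fun i => pauli (s'' i)) 1 1 = fun i => pauli (s'' i) := by
              funext i
              simp only [upd]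
              split_ifs with h1 h2
              · rw [hz i (Or.inl h1), pauli_zero]
              · rw [hz i (Or.inr h2), pauli_zero]
              · rfl
            rw [hup, ← pauliString_eq] at hc
            rw [← mul_assoc, hG, hc, mul_assoc, ← hG, GG_mul_inv, mul_one])
      refine ⟨x', le_trans ?_ hx'⟩
      have := Sv_mono A x1 k
      rw [hSk] at this
      omega

lemma rank_grow (n T L : ℕ) (hn : 2 ≤ n) (hT : T ≤ 4 ^ n - 1) (A : Architecture n (T * L))
    (hslices : ∀ s < T, IsCausalSlice A (s * L) ((s + 1) * L)) :
    ∃ x : Fin (T * L) → SU4, T + 1 ≤ Module.finrank ℂ (Sv A x (T * L)) := by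
  have key : ∀ m ≤ T, ∃ x : Fin (T * L) → SU4, m + 1 ≤ Module.finrank ℂ (Sv A x (m * L)) := by
    intro m
    induction m with
    | zero =>
      intro _
      refine ⟨1, ?_⟩
      have h0 : Sv A 1 (0 * L) = Submodule.span ℂ {1} := by rw [zero_mul]; rfl
      rw [h0, finrank_span_singleton one_ne_zero]
    | succ m ih =>
      intro hm
      obtain ⟨x, hx⟩ := ih (by omega)
      by_cases hall : ∀ s, pauliString s ∈ Sv A x (m * L)
      · refine ⟨x, le_trans ?_ (Sv_mono' A x (Nat.mul_le_mul_right L (Nat.le_succ m)))⟩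
        have htop : Sv A x (m * L) = ⊤ := by
          rw [eq_top_iff, ← span_pauli n, Submodule.span_le]
          rintro _ ⟨s, rfl⟩
          exact hall s
        rw [htop, finrank_top, Module.finrank_matrix]
        simp only [Fintype.card_pi, Fintype.card_fin, Finset.prod_const, Finset.card_univ,
          Module.finrank_self, mul_one]
        rw [← mul_pow]
        norm_num
        have : 0 < 4 ^ n := by positivity
        omega
      · push Not at hall
        obtain ⟨s, hs⟩ := hall
        obtain ⟨t, ht⟩ := hslices m (by omega)
        have hr : ∀ q, Rch A ((m + 1) * L) t (m * L) q := by
          intro q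
          obtain ⟨M, idx, qs, h1, h2, h3, h4, h5⟩ := ht q
          rw [← h3]
          exact Rch.of_path M _ idx qs (Nat.mul_le_mul_right L (Nat.le_succ m)) h1 h2 h4 h5
        obtain ⟨q, hq⟩ : ∃ q : Fin n, q ≠ t := by
          haveI : Nontrivial (Fin n) := Fin.nontrivial_iff_two_le.mpr hn
          exact exists_ne t
        obtain ⟨x', hx'⟩ := slice_grow A ((m + 1) * L) (Nat.mul_le_mul_right L hm) t L (m * L)
          (by ring) x s hs (fun q _ => hr q) (Or.inl ((hr q).touch hq))
        exact ⟨x', by omega⟩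
  exact key T le_rfl

/-! ## The derivative of the contraction map -/

section Deriv
attribute [local instance] Matrix.linftyOpNormedRing Matrix.linftyOpNormedAlgebra

lemma Phi_deriv {n R : ℕ} (A : Architecture n R) (x : Fin R → SU4) (k : ℕ) (hk : k ≤ R) :
    ∃ D : (Fin R → M4) →L[ℂ] NMatrix n,
      HasStrictFDerivAt (𝕜 := ℂ) (fun y : Fin R → M4 => Phi A y k) D (cl x) ∧
      (∀ X : Fin R → M4, (∀ j : Fin R, j.1 < k → X j = 0) → D X = 0) ∧
      D (cl x) = (k : ℂ) • Phi A (cl x) k ∧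
      ∀ S ∈ Sv A x k, ∃ (X : Fin R → M4) (c : ℂ), (∀ j : Fin R, k ≤ j.1 → X j = 0) ∧
        D X + c • Phi A (cl x) k = S * Phi A (cl x) k := by
  induction k with
  | zero =>
    refine ⟨0, hasStrictFDerivAt_const (1 : NMatrix n) _, fun _ _ => rfl, by simp, ?_⟩
    intro S hS
    obtain ⟨c, rfl⟩ := Submodule.mem_span_singleton.mp hS
    exact ⟨0, c, fun _ _ => rfl, by simp [Phi]⟩
  | succ k ih =>
    obtain ⟨D, h1, h2, h3, h4⟩ := ih (by omega)
    have hkR : k < R := by omega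
    set kk : Fin R := ⟨k, hkR⟩ with hkk
    set E : M4 →L[ℂ] NMatrix n := LinearMap.toContinuousLinearMap (embC (A kk).1) with hE
    have hEa : ∀ u, E u = embedGate (A kk).1 u := fun u => rfl
    have hGG : ∀ y : Fin R → M4, GG A y k = E (y kk) := by
      intro y; simp [GG, hkR, hEa, hkk]
    have hd : HasStrictFDerivAt (𝕜 := ℂ) (fun y : Fin R → M4 => E (y kk))
        (E ∘L ContinuousLinearMap.proj kk) (cl x) :=
      (E ∘L (ContinuousLinearMap.proj kk : (Fin R → M4) →L[ℂ] M4)).hasStrictFDerivAt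
    obtain ⟨D', hD', hm⟩ : ∃ D' : (Fin R → M4) →L[ℂ] NMatrix n,
        (∀ X, D' X = E (cl x kk) * D X + E (X kk) * Phi A (cl x) k) ∧
        HasStrictFDerivAt (𝕜 := ℂ) (fun y : Fin R → M4 => Phi A y (k + 1)) D' (cl x) := by
      have hm := hd.mul' h1
      have he : ((fun y : Fin R → M4 => E (y kk)) * fun y => Phi A y k) =
          fun y : Fin R → M4 => Phi A y (k + 1) := by
        funext y
        simp only [Phi, hGG]; rfl
      rw [he] at hm
      exact ⟨_, fun X => rfl, hm⟩
    have hP : Phi A (cl x) (k + 1) = E (cl x kk) * Phi A (cl x) k := by simp only [Phi, hGG]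
    refine ⟨D', hm, ?_, ?_, ?_⟩
    · intro X hX
      rw [hD', h2 X (fun j hj => hX j (by omega)), hX kk (by simp [hkk])]
      simp
    · rw [hD', h3, hP, mul_smul_comm]
      push_cast
      rw [add_smul, one_smul]
    · intro S hS
      simp only [Sv] at hS
      obtain ⟨S1, hS1, S2, hS2, rfl⟩ := Submodule.mem_sup.mp hS
      obtain ⟨S0, hS0, rfl⟩ := hS1
      obtain ⟨X0, c, hX0, hX⟩ := h4 S0 hS0
      rw [hh, dif_pos hkR] at hS2
      obtain ⟨H, rfl⟩ := hS2
      refine ⟨X0 + Pi.single kk (H * cl x kk), c, ?_, ?_⟩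
      · intro j hj
        have : j ≠ kk := by intro h; rw [h] at hj; simp [hkk] at hj
        simp [this, hX0 j (by omega)]
      · have hz : D (Pi.single kk (H * cl x kk)) = 0 := by
          apply h2
          intro j hj
          have : j ≠ kk := by intro h; rw [h] at hj; simp [hkk] at hj
          simp [this]
        have hc : cj (GG A (cl x) k) (GG A (cl x⁻¹) k) S0 * Phi A (cl x) (k + 1)
            = E (cl x kk) * (S0 * Phi A (cl x) k) := by
          simp only [cj, LinearMap.comp_apply, LinearMap.mulLeft_apply, LinearMap.mulRight_apply, Phi]
          rw [mul_assoc, mul_assoc, ← mul_assoc (GG A (cl x⁻¹) k), GG_inv_mul, one_mul, hGG]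
        have he : embC (A ⟨k, hkR⟩).1 H * Phi A (cl x) (k + 1)
            = E (H * cl x kk) * Phi A (cl x) k := by
          rw [hP, ← mul_assoc, hEa, hEa, embed_mul (A kk).2]; rfl
        rw [add_mul, hc, he, ← hX, hD', map_add, hz, hP, Pi.add_apply, hX0 kk (le_refl _)]
        simp only [Pi.single_eq_same, zero_add, mul_add, add_zero, mul_smul_comm]; abel

lemma Phi_deriv_range {n R : ℕ} (A : Architecture n R) (x : Fin R → SU4) (hR : R ≠ 0) (d : ℕ)
    (hd : d ≤ Module.finrank ℂ (Sv A x R)) :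
    ∃ D : (Fin R → M4) →L[ℂ] NMatrix n,
      HasStrictFDerivAt (𝕜 := ℂ) (fun y : Fin R → M4 => Phi A y R) D (cl x) ∧
      d ≤ Module.finrank ℂ (LinearMap.range D.toLinearMap) := by
  obtain ⟨D, h1, h2, h3, h4⟩ := Phi_deriv A x R le_rfl
  refine ⟨D, h1, hd.trans ?_⟩
  have hinv : Phi A (cl x) R * (Phi A (cl x) R)⁻¹ = 1 := by
    apply Matrix.mul_nonsing_inv
    have : ∀ k, IsUnit (Phi A (cl x) k) := by
      intro k
      induction k with
      | zero => exact isUnit_one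
      | succ k ih =>
        exact IsUnit.mul ⟨⟨_, _, GG_mul_inv A x k, GG_inv_mul A x k⟩, rfl⟩ ih
    exact (Matrix.isUnit_iff_isUnit_det _).mp (this R)
  have hinj : Function.Injective (LinearMap.mulRight ℂ (Phi A (cl x) R)) := by
    intro M N h
    simp only [LinearMap.mulRight_apply] at h
    have := congrArg (· * (Phi A (cl x) R)⁻¹) h
    simpa only [mul_assoc, hinv, mul_one] using this
  rw [(LinearEquiv.finrank_eq (Submodule.equivMapOfInjective _ hinj (Sv A x R)))]
  apply Submodule.finrank_mono
  rintro _ ⟨S, hS, rfl⟩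
  obtain ⟨X, c, -, hX⟩ := h4 S hS
  refine ⟨X + (c / R) • cl x, ?_⟩
  have hR' : (R : ℂ) ≠ 0 := by exact_mod_cast hR
  simp only [LinearMap.mulRight_apply, ContinuousLinearMap.coe_coe, map_add, map_smul, h3, ← hX,
    smul_smul, div_mul_cancel₀ c hR']

/-- A linear projection of the contraction map whose image is Zariski dense. -/
lemma exists_proj {n R : ℕ} (A : Architecture n R) (x : Fin R → SU4) (hR : R ≠ 0) (d : ℕ)
    (hd : d ≤ Module.finrank ℂ (Sv A x R)) :
    ∃ l : NMatrix n →ₗ[ℂ] (Fin d → ℂ), ∀ P : MvPolynomial (Fin d) ℂ, P ≠ 0 →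
      ∃ M : Fin R → M4, MvPolynomial.eval (l (Phi A M R)) P ≠ 0 := by
  obtain ⟨D, h1, h2⟩ := Phi_deriv_range A x hR d hd
  obtain ⟨l, hl⟩ : ∃ l : NMatrix n →ₗ[ℂ] (Fin d → ℂ),
      Function.Surjective (l ∘ₗ D.toLinearMap) := by
    set W := LinearMap.range D.toLinearMap
    obtain ⟨f, hf⟩ := exists_linearIndependent_of_le_finrank (R := ℂ) (M := W) h2
    have hf' : LinearIndependent ℂ (fun i => (f i : NMatrix n)) :=
      hf.map' W.subtype (Submodule.ker_subtype W)
    obtain ⟨g, hg⟩ := LinearMap.exists_leftInverse_of_injective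
      (Fintype.linearCombination ℂ (fun i => (f i : NMatrix n)))
      (LinearMap.ker_eq_bot.mpr (linearIndependent_iff_injective_fintypeLinearCombination.mp hf'))
    refine ⟨g, fun v => ?_⟩
    have hm : Fintype.linearCombination ℂ (fun i => (f i : NMatrix n)) v ∈ W := by
      rw [Fintype.linearCombination_apply]
      exact Submodule.sum_mem _ fun i _ => Submodule.smul_mem _ _ (f i).2
    obtain ⟨X, hX⟩ := hm
    refine ⟨X, ?_⟩
    rw [LinearMap.comp_apply, hX, ← LinearMap.comp_apply, hg]; rfl
  refine ⟨l, fun P hP => ?_⟩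
  have hs : HasStrictFDerivAt (𝕜 := ℂ) (fun y : Fin R → M4 => l (Phi A y R))
      ((LinearMap.toContinuousLinearMap l) ∘L D) (cl x) :=
    (LinearMap.toContinuousLinearMap l).hasStrictFDerivAt.comp (cl x) h1
  have hmap := hs.map_nhds_eq_of_surj (LinearMap.range_eq_top.mpr hl)
  by_contra! hc
  apply hP
  have hnb : Set.range (fun y : Fin R → M4 => l (Phi A y R)) ∈
      nhds (l (Phi A (cl x) R)) := by
    rw [← hmap, Filter.mem_map]
    exact Filter.univ_mem' fun y => ⟨y, rfl⟩
  obtain ⟨ε, hε, hb⟩ := Metric.mem_nhds_iff.mp hnb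
  rw [ball_pi _ hε] at hb
  refine MvPolynomial.funext_set (fun i => Metric.ball (l (Phi A (cl x) R) i) ε) ?_ ?_
  · intro i
    exact infinite_of_mem_nhds (l (Phi A (cl x) R) i) (Metric.ball_mem_nhds _ hε)
  · intro v hv
    obtain ⟨M, hM⟩ := hb hv
    simp only at hM
    rw [← hM, hc, map_zero]
end Deriv

/-! ## The upper bound on the number of parameters -/

section Upper
attribute [local instance] Matrix.linftyOpNormedRing Matrix.linftyOpNormedAlgebra

lemma entire_eq_zero {h : ℂ → ℂ} (hd : Differentiable ℂ h) {z0 : ℂ}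
    (hf : ∃ᶠ z in nhdsWithin z0 {z0}ᶜ, h z = 0) (z : ℂ) : h z = 0 := by
  have ha : AnalyticOnNhd ℂ h Set.univ := fun z _ => hd.analyticAt z
  have := ha.eq_of_frequently_eq (g := fun _ => 0) (fun z _ => analyticAt_const) hf
  rw [this]

lemma diff_zero_of_nhds {E : Type*} [NormedAddCommGroup E] [NormedSpace ℂ E] {φ : E → ℂ}
    (hd : Differentiable ℂ φ) {u0 : E} (hev : ∀ᶠ u in nhds u0, φ u = 0) (u : E) : φ u = 0 := by
  have hd2 : Differentiable ℂ (fun z : ℂ => φ (u0 + z • (u - u0))) := by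
    apply hd.comp
    exact (differentiable_const _).add (differentiable_id.smul_const _)
  have hc : Filter.Tendsto (fun z : ℂ => u0 + z • (u - u0)) (nhds 0) (nhds u0) := by
    have : Continuous (fun z : ℂ => u0 + z • (u - u0)) := by fun_prop
    simpa using this.tendsto 0
  have h1 := entire_eq_zero hd2 (z0 := 0)
    ((Filter.Eventually.filter_mono nhdsWithin_le_nhds (hc.eventually hev)).frequently) 1
  simpa using h1

noncomputable def sig : (Fin 9 → ℂ) →ₗ[ℂ] M4 where
  toFun e := !![0, 0, 0, 0; e 0, 0, 0, e 1; e 2, 0, e 3, e 4; e 5, e 6, e 7, e 8]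
  map_add' e e' := by
    ext i j; fin_cases i <;> fin_cases j <;> simp
  map_smul' c e := by
    ext i j; fin_cases i <;> fin_cases j <;> simp

noncomputable def s0 : M4 := !![1, 0, 0, 1; 0, 0, 0, 0; 0, 1, 0, 0; 0, 0, 0, 0]

noncomputable def secn (e : Fin 9 → ℂ) : M4 := s0 + sig e

noncomputable def kL : M2 →ₗ[ℂ] M4 where
  toFun a := k2 a 1
  map_add' a b := by
    funext i j; simp only [k2, Matrix.add_apply]; ring
  map_smul' c a := by
    funext i j; simp only [k2, Matrix.smul_apply, RingHom.id_apply, smul_eq_mul]; ring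

noncomputable def kR : M2 →ₗ[ℂ] M4 where
  toFun a := k2 1 a
  map_add' a b := by
    funext i j; simp only [k2, Matrix.add_apply]; ring
  map_smul' c a := by
    funext i j; simp only [k2, Matrix.smul_apply, RingHom.id_apply, smul_eq_mul]; ring

noncomputable def e0 : Fin 9 → ℂ := ![1, 0, 0, 0, 0, 0, 0, 0, 0]

lemma surj_aux (U : M4) : ∃ (e : Fin 9 → ℂ) (a b : M2),
    sig e + secn e0 * (kL a + kR b) = U := by
  refine ⟨![U 1 0 - U 0 0, U 1 3, U 2 0 - (U 0 2 - U 1 2), U 2 2, U 2 3 - U 1 2,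
      U 3 0, U 3 1, U 3 2, U 3 3],
    !![U 0 0, U 1 2; U 0 1 - U 1 1, U 0 3 - (U 2 1 - U 0 0)],
    !![0, U 1 1; U 0 2 - U 1 2, U 2 1 - U 0 0], ?_⟩
  have hH : hiB = ![0, 0, 1, 1] := by decide
  have hL : loB = ![0, 1, 0, 1] := by decide
  have eL : ∀ a i j, kL a i j = a (hiB i) (hiB j) *
      (if (![0, 1, 0, 1] : Fin 4 → Fin 2) i = (![0, 1, 0, 1] : Fin 4 → Fin 2) j then 1 else 0) := by
    intro a i j; rw [← hL, ← Matrix.one_apply]; rfl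
  have eR : ∀ a i j, kR a i j =
      (if (![0, 0, 1, 1] : Fin 4 → Fin 2) i = (![0, 0, 1, 1] : Fin 4 → Fin 2) j then 1 else 0) *
        a (loB i) (loB j) := by
    intro a i j; rw [← hH, ← Matrix.one_apply]; rfl
  have eS : ∀ e : Fin 9 → ℂ, sig e =
      !![0, 0, 0, 0; e 0, 0, 0, e 1; e 2, 0, e 3, e 4; e 5, e 6, e 7, e 8] := fun _ => rfl
  ext i j
  rw [Matrix.add_apply, Matrix.mul_apply, Fin.sum_univ_four]
  simp only [Matrix.add_apply, eL, eR, secn, eS, hH, hL]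
  fin_cases i <;> fin_cases j <;>
    simp [s0, e0]

lemma open_mul {B V : Type*} [NormedRing B] [NormedAlgebra ℂ B] [CompleteSpace B]
    [NormedAddCommGroup V] [NormedSpace ℂ V] [CompleteSpace V] (L1 L2 L3 : V →L[ℂ] B) (s : B)
    (v0 : V) (hs : ∀ U, ∃ v, (s + L1 v0) * (L2 v0 * L3 v + L2 v * L3 v0) +
      L1 v * (L2 v0 * L3 v0) = U) {φ : B → ℂ} (hd : Differentiable ℂ φ)
    (h : ∀ v, φ ((s + L1 v) * (L2 v * L3 v)) = 0) (u : B) : φ u = 0 := by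
  have d := (L1.hasStrictFDerivAt (x := v0) |>.const_add s).mul'
    ((L2.hasStrictFDerivAt (x := v0)).mul' (L3.hasStrictFDerivAt (x := v0)))
  have hmap := d.map_nhds_eq_of_surj (LinearMap.range_eq_top.mpr (fun U => hs U))
  have hq := (Filter.eventually_map (P := fun w => φ w = 0) (f := nhds v0)
    (m := (fun v => s + L1 v) * ((L2 : V → B) * (L3 : V → B)))).mpr
    (Filter.Eventually.of_forall h)
  rw [hmap] at hq
  exact diff_zero_of_nhds hd hq u

lemma density {φ : M4 → ℂ} (hd : Differentiable ℂ φ)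
    (h : ∀ e a b, φ (secn e * k2 a b) = 0) (u : M4) : φ u = 0 := by
  have h' : ∀ (e : Fin 9 → ℂ) (a b : M2), φ (secn e * (k2 a 1 * k2 1 b)) = 0 := by
    intro e a b
    rw [k2_mul, mul_one, one_mul]
    exact h e a b
  have hcs : CompleteSpace M4 := FiniteDimensional.complete ℂ _
  let F2 := Fin 2 → Fin 2 → ℂ
  let V := (Fin 9 → ℂ) × F2 × F2
  let kL' : F2 →ₗ[ℂ] M4 := kL ∘ₗ (Matrix.ofLinearEquiv ℂ).toLinearMap
  let kR' : F2 →ₗ[ℂ] M4 := kR ∘ₗ (Matrix.ofLinearEquiv ℂ).toLinearMap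
  let L1 : V →ₗ[ℂ] M4 := sig ∘ₗ LinearMap.fst ℂ _ _
  let L2 : V →ₗ[ℂ] M4 := kL' ∘ₗ LinearMap.fst ℂ _ _ ∘ₗ LinearMap.snd ℂ _ _
  let L3 : V →ₗ[ℂ] M4 := kR' ∘ₗ LinearMap.snd ℂ _ _ ∘ₗ LinearMap.snd ℂ _ _
  have ek1 : kL 1 = 1 := k2_one
  have ek2 : kR 1 = 1 := k2_one
  refine open_mul (V := V) (LinearMap.toContinuousLinearMap L1) (LinearMap.toContinuousLinearMap L2)
    (LinearMap.toContinuousLinearMap L3) s0 (e0, (1 : M2), (1 : M2)) ?_ hd ?_ u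
  · intro U
    obtain ⟨e, a, b, hU⟩ := surj_aux U
    refine ⟨(e, a, b), ?_⟩
    rw [← hU]
    change secn e0 * (kL 1 * kR b + kL a * kR 1) + sig e * (kL 1 * kR 1) = _
    rw [ek1, ek2, one_mul, mul_one, mul_one, mul_one, add_comm (kR b), add_comm]
  · rintro ⟨e, a, b⟩
    exact h' e a b

lemma reduce_sec {n R : ℕ} (A : Architecture n R) (k : ℕ) (hk : k ≤ R) :
    ∀ f : NMatrix n → ℂ, Differentiable ℂ f →
      (∀ (c : Fin R → Fin 9 → ℂ) (g : Fin n → M2),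
        f (Phi A (fun j => secn (c j)) k * tens g) = 0) →
      ∀ (x : Fin R → M4) (g : Fin n → M2), f (tens g * Phi A x k) = 0 := by
  induction k with
  | zero =>
    intro f _ h x g
    have := h 0 g
    simpa [Phi] using this
  | succ k ih =>
    intro f hf h x g
    have hkR : k < R := by omega
    set kk : Fin R := ⟨k, hkR⟩ with hkk
    have hp := (A kk).2
    have hGG : ∀ y : Fin R → M4, GG A y k = embedGate (A kk).1 (y kk) := by
      intro y; simp [GG, hkR, hkk]
    have h1 : ∀ (e : Fin 9 → ℂ) (g : Fin n → M2),
        f (embedGate (A kk).1 (secn e) * (tens g * Phi A x k)) = 0 := by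
      intro e g
      refine ih (by omega) (fun M => f (embedGate (A kk).1 (secn e) * M))
        (hf.comp ((differentiable_const _).mul differentiable_id)) ?_ x g
      intro c g
      have := h (Function.update c kk e) g
      simp only [Phi, hGG, Function.update_self] at this
      rw [Phi_congr A (y := fun j => secn (c j)), mul_assoc] at this
      · exact this
      · intro j hj
        rw [Function.update_of_ne]
        intro h; rw [h] at hj; simp [hkk] at hj
    have h2 : ∀ u : M4, f (embedGate (A kk).1 u * (tens (upd (A kk).1 g 1 1) * Phi A x k)) = 0 := by
      refine density (φ := fun u =>
        f (embedGate (A kk).1 u * (tens (upd (A kk).1 g 1 1) * Phi A x k))) ?_ ?_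
      · apply hf.comp
        exact (LinearMap.toContinuousLinearMap (embC (A kk).1)).differentiable.mul
          (differentiable_const _)
      · intro e a b
        have := h1 e (upd (A kk).1 g a b)
        rw [tens_eq_embed hp (upd (A kk).1 g a b)] at this
        have e1 : upd (A kk).1 g a b (A kk).1.1 = a := by simp [upd]
        have e2 : upd (A kk).1 g a b (A kk).1.2 = b := by simp [upd, hp.symm]
        have e3 : upd (A kk).1 (upd (A kk).1 g a b) 1 1 = upd (A kk).1 g 1 1 := by
          funext i; simp only [upd]; split_ifs <;> rfl
        rw [e1, e2, e3] at this
        rw [embed_mul hp]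
        simpa only [mul_assoc] using this
    have := h2 (k2 (g (A kk).1.1) (g (A kk).1.2) * x kk)
    rw [← mul_assoc, ← tens_mul_embed hp] at this
    simp only [Phi, hGG]
    rwa [← mul_assoc]

noncomputable def nrm (t : Fin 3 → ℂ) : M2 := !![1, t 0; t 1, t 2]

lemma reduce_site {n : ℕ} (f : NMatrix n → ℂ) (hf : Differentiable ℂ f) (B : NMatrix n)
    (h : ∀ (l : ℂ) (t : Fin n → Fin 3 → ℂ), f (l • (B * tens (fun i => nrm (t i)))) = 0)
    (l : ℂ) (g : Fin n → M2) : f (l • (B * tens g)) = 0 := by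
  have h1 : ∀ g : Fin n → M2, (∀ i, g i 0 0 ≠ 0) → f (l • (B * tens g)) = 0 := by
    intro g hg
    have : tens g = (∏ i, g i 0 0) • tens (fun i => nrm (fun j =>
        (![g i 0 1, g i 1 0, g i 1 1] j) / g i 0 0)) := by
      funext a b
      simp only [tens, Matrix.smul_apply, smul_eq_mul, ← Finset.prod_mul_distrib]
      refine Finset.prod_congr rfl fun i _ => ?_
      have := hg i
      generalize a i = p
      generalize b i = q
      fin_cases p <;> fin_cases q <;> simp [nrm] <;> field_simp
    rw [this, mul_smul_comm, smul_smul]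
    exact h _ _
  have hev : ∀ᶠ z : ℂ in nhdsWithin 0 {0}ᶜ, f (l • (B * tens (fun i => g i + z • 1))) = 0 := by
    have : ∀ᶠ z : ℂ in nhdsWithin 0 {0}ᶜ, ∀ i, (g i + z • (1 : M2)) 0 0 ≠ 0 := by
      rw [Filter.eventually_all]
      intro i
      simp only [Matrix.add_apply, Matrix.smul_apply, Matrix.one_apply_eq, smul_eq_mul, mul_one]
      by_cases hgi : g i 0 0 = 0
      · rw [hgi]
        filter_upwards [self_mem_nhdsWithin] with z hz
        simpa using hz
      · apply Filter.Eventually.filter_mono nhdsWithin_le_nhds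
        have hc : Continuous (fun z : ℂ => g i 0 0 + z) := by fun_prop
        exact hc.continuousAt.eventually_ne (by simpa using hgi)
    filter_upwards [this] with z hz
    exact h1 _ hz
  have hcont : Continuous (fun z : ℂ => f (l • (B * tens (fun i => g i + z • 1)))) := by
    apply hf.continuous.comp
    refine Continuous.comp (continuous_const_smul l) ?_
    apply Continuous.matrix_mul continuous_const
    apply continuous_matrix
    intro a b
    simp only [tens, Matrix.add_apply, Matrix.smul_apply]
    fun_prop
  have ht : Filter.Tendsto (fun z : ℂ => f (l • (B * tens (fun i => g i + z • 1))))
      (nhdsWithin 0 {0}ᶜ) (nhds (f (l • (B * tens g)))) := by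
    have := (hcont.tendsto 0).mono_left (nhdsWithin_le_nhds (s := {0}ᶜ))
    simpa using this
  exact tendsto_nhds_unique (ht.congr' hev) tendsto_const_nhds |>.symm ▸ rfl

end Upper

/-! ## Algebraic dependence -/

def PolyFn {σ : Type} (F : (σ → ℂ) → ℂ) : Prop :=
  ∃ q : MvPolynomial σ ℂ, ∀ v, MvPolynomial.eval v q = F v

namespace PolyFn
variable {σ : Type}

lemma const (c : ℂ) : PolyFn (fun _ : σ → ℂ => c) := ⟨MvPolynomial.C c, by simp⟩
lemma coord (s : σ) : PolyFn (fun v : σ → ℂ => v s) := ⟨MvPolynomial.X s, by simp⟩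
lemma add {F G : (σ → ℂ) → ℂ} (hF : PolyFn F) (hG : PolyFn G) : PolyFn (fun v => F v + G v) := by
  obtain ⟨p, hp⟩ := hF
  obtain ⟨q, hq⟩ := hG
  exact ⟨p + q, by simp [hp, hq]⟩
lemma mul {F G : (σ → ℂ) → ℂ} (hF : PolyFn F) (hG : PolyFn G) : PolyFn (fun v => F v * G v) := by
  obtain ⟨p, hp⟩ := hF
  obtain ⟨q, hq⟩ := hG
  exact ⟨p * q, by simp [hp, hq]⟩
lemma sum {ι : Type*} (s : Finset ι) {F : ι → (σ → ℂ) → ℂ} (hF : ∀ i, PolyFn (F i)) :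
    PolyFn (fun v => ∑ i ∈ s, F i v) := by
  choose q hq using hF
  exact ⟨∑ i ∈ s, q i, by simp [hq]⟩
lemma prod {ι : Type*} (s : Finset ι) {F : ι → (σ → ℂ) → ℂ} (hF : ∀ i, PolyFn (F i)) :
    PolyFn (fun v => ∏ i ∈ s, F i v) := by
  choose q hq using hF
  exact ⟨∏ i ∈ s, q i, by simp [hq]⟩
end PolyFn

lemma alg_dep {σ : Type} [Fintype σ] {d : ℕ} (hd : Fintype.card σ < d)
    (F : Fin d → (σ → ℂ) → ℂ) (hF : ∀ i, PolyFn (F i)) :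
    ∃ P : MvPolynomial (Fin d) ℂ, P ≠ 0 ∧ ∀ v, MvPolynomial.eval (fun i => F i v) P = 0 := by
  choose q hq using hF
  have hnot : ¬ AlgebraicIndependent ℂ q := by
    intro h
    have := h.lift_cardinalMk_le_trdeg
    rw [MvPolynomial.trdeg_of_isDomain] at this
    simp at this
    omega
  rw [algebraicIndependent_iff] at hnot
  push Not at hnot
  obtain ⟨P, hP, hP0⟩ := hnot
  refine ⟨P, hP0, fun v => ?_⟩
  have h1 : MvPolynomial.eval v (MvPolynomial.aeval q P) = 0 := by rw [hP, map_zero]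
  rw [← h1, MvPolynomial.aeval_def, MvPolynomial.eval₂_eq', MvPolynomial.eval_eq']
  simp [hq]

section Upper2
attribute [local instance] Matrix.linftyOpNormedRing Matrix.linftyOpNormedAlgebra

lemma eval_diff {n d : ℕ} (l : NMatrix n →ₗ[ℂ] (Fin d → ℂ)) (P : MvPolynomial (Fin d) ℂ) :
    Differentiable ℂ (fun M : NMatrix n => MvPolynomial.eval (l M) P) := by
  induction P using MvPolynomial.induction_on with
  | C a => simp
  | add p q hp hq => simp only [map_add]; exact hp.add hq
  | mul_X p i hp =>
    have h : Differentiable ℂ (fun M : NMatrix n => l M i) :=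
      (LinearMap.toContinuousLinearMap ((LinearMap.proj i : (Fin d → ℂ) →ₗ[ℂ] ℂ) ∘ₗ l)).differentiable
    simp only [map_mul, MvPolynomial.eval_X]; exact hp.mul h

abbrev Sig (n R : ℕ) := (Fin R × Fin 9) ⊕ (Fin n × Fin 3) ⊕ Unit

noncomputable def par {n R : ℕ} (A : Architecture n R) (v : Sig n R → ℂ) : NMatrix n :=
  v (Sum.inr (Sum.inr ())) • (Phi A (fun j => secn (fun m => v (Sum.inl (j, m)))) R *
    tens (fun i => nrm (fun m => v (Sum.inr (Sum.inl (i, m))))))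

lemma par_poly {n R : ℕ} (A : Architecture n R) (a b : QubitBasis n) :
    PolyFn (fun v : Sig n R → ℂ => par A v a b) := by
  have h1 : ∀ (j : Fin R) (p q : Fin 4),
      PolyFn (fun v : Sig n R → ℂ => secn (fun m => v (Sum.inl (j, m))) p q) := by
    intro j p q
    have eS : ∀ e : Fin 9 → ℂ, sig e =
      !![0, 0, 0, 0; e 0, 0, 0, e 1; e 2, 0, e 3, e 4; e 5, e 6, e 7, e 8] := fun _ => rfl
    simp only [secn, Matrix.add_apply, eS]
    refine PolyFn.add (PolyFn.const _) ?_
    fin_cases p <;> fin_cases q <;> simp <;> first | exact PolyFn.const _ | exact PolyFn.coord _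
  have h2 : ∀ (k : ℕ) (a b : QubitBasis n), PolyFn (fun v : Sig n R → ℂ =>
      GG A (fun j => secn (fun m => v (Sum.inl (j, m)))) k a b) := by
    intro k a b
    unfold GG
    split_ifs with h
    · simp only [embedGate]
      split_ifs
      · exact h1 _ _ _
      · exact PolyFn.const _
    · exact PolyFn.const _
  have h3 : ∀ (k : ℕ) (a b : QubitBasis n), PolyFn (fun v : Sig n R → ℂ =>
      Phi A (fun j => secn (fun m => v (Sum.inl (j, m)))) k a b) := by
    intro k
    induction k with
    | zero => intro a b; exact PolyFn.const _
    | succ k ih =>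
      intro a b
      simp only [Phi, Matrix.mul_apply]
      exact PolyFn.sum _ fun i => (h2 k a i).mul (ih i b)
  simp only [par, Matrix.smul_apply, Matrix.mul_apply, smul_eq_mul]
  refine (PolyFn.coord _).mul (PolyFn.sum _ fun c => (h3 R a c).mul ?_)
  simp only [tens]
  refine PolyFn.prod _ fun i => ?_
  generalize c i = p
  generalize b i = q
  fin_cases p <;> fin_cases q <;> simp [nrm] <;> first | exact PolyFn.const _ | exact PolyFn.coord _

lemma exists_relation {n R d : ℕ} (A : Architecture n R) (hd : 9 * R + 3 * n + 1 < d)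
    (l : NMatrix n →ₗ[ℂ] (Fin d → ℂ)) :
    ∃ P : MvPolynomial (Fin d) ℂ, P ≠ 0 ∧
      ∀ (c : ℂ) (x : Fin R → M4), MvPolynomial.eval (l (c • Phi A x R)) P = 0 := by
  obtain ⟨P, hP, hv⟩ := alg_dep (σ := Sig n R) (d := d) (by simp; omega)
    (fun i v => l (par A v) i) (by
      intro i
      have hlin : ∀ M : NMatrix n, l M i = ∑ a, ∑ b, M a b * l (Matrix.single a b 1) i := by
        intro M
        conv_lhs => rw [Matrix.matrix_eq_sum_single M]
        simp only [map_sum, Finset.sum_apply]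
        refine Finset.sum_congr rfl fun a _ => Finset.sum_congr rfl fun b _ => ?_
        have : Matrix.single a b (M a b) = M a b • Matrix.single a b (1 : ℂ) := by
          rw [Matrix.smul_single, smul_eq_mul, mul_one]
        rw [this, map_smul]; rfl
      simp only [fun v : Sig n R → ℂ => hlin (par A v)]
      exact PolyFn.sum _ fun a => PolyFn.sum _ fun b => (par_poly A a b).mul (PolyFn.const _))
  refine ⟨P, hP, fun c x => ?_⟩
  have hf := eval_diff l P
  have h1 : ∀ (e : Fin R → Fin 9 → ℂ) (c : ℂ) (g : Fin n → M2),
      MvPolynomial.eval (l (c • (Phi A (fun j => secn (e j)) R * tens g))) P = 0 := by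
    intro e
    refine reduce_site (fun M => MvPolynomial.eval (l M) P) hf _ ?_
    intro c t
    exact hv (Sum.elim (fun p => e p.1 p.2) (Sum.elim (fun p => t p.1 p.2) (fun _ => c)))
  have h2 := reduce_sec A R le_rfl (fun M => MvPolynomial.eval (l (c • M)) P)
    (hf.comp (differentiable_id.const_smul c)) (fun e g => h1 e c g) x 1
  rwa [tens_one, one_mul] at h2
end Upper2

/-! ## Zariski density of the special unitary tuples -/

section Dens
attribute [local instance] Matrix.linftyOpNormedRing Matrix.linftyOpNormedAlgebra

lemma Phi_diff {n R : ℕ} (A : Architecture n R) (k : ℕ) :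
    Differentiable ℂ (fun x : Fin R → M4 => Phi A x k) := by
  induction k with
  | zero => exact differentiable_const _
  | succ k ih =>
    simp only [Phi]
    refine Differentiable.mul ?_ ih
    unfold GG
    split_ifs with h
    · exact ((LinearMap.toContinuousLinearMap (embC (A ⟨k, h⟩).1)) ∘L
        (ContinuousLinearMap.proj (⟨k, h⟩ : Fin R) : (Fin R → M4) →L[ℂ] M4)).differentiable
    · exact differentiable_const _

lemma Phi_smul {n R : ℕ} (A : Architecture n R) (c : Fin R → ℂ) (x : Fin R → M4) (k : ℕ) :
    ∃ l : ℂ, Phi A (fun j => c j • x j) k = l • Phi A x k := by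
  induction k with
  | zero => exact ⟨1, by simp [Phi]⟩
  | succ k ih =>
    obtain ⟨l, hl⟩ := ih
    by_cases h : k < R
    · refine ⟨c ⟨k, h⟩ * l, ?_⟩
      have : GG A (fun j => c j • x j) k = c ⟨k, h⟩ • GG A x k := by
        simp only [GG, dif_pos h]
        exact (embC (A ⟨k, h⟩).1).map_smul _ _
      simp only [Phi]
      rw [hl, this, smul_mul_smul_comm]
    · refine ⟨l, ?_⟩
      simp only [Phi, GG, dif_neg h, one_mul, hl]

lemma entire_real {h : ℂ → ℂ} (hd : Differentiable ℂ h) (hr : ∀ t : ℝ, h t = 0) (z : ℂ) :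
    h z = 0 := by
  refine entire_eq_zero hd (z0 := 0) ?_ z
  have ht : Filter.Tendsto (fun t : ℝ => (t : ℂ)) (nhdsWithin 0 {0}ᶜ) (nhdsWithin 0 {0}ᶜ) := by
    refine tendsto_nhdsWithin_iff.mpr ⟨?_, ?_⟩
    · have : Filter.Tendsto (fun t : ℝ => (t : ℂ)) (nhds 0) (nhds 0) := by
        simpa using Complex.continuous_ofReal.tendsto 0
      exact this.mono_left nhdsWithin_le_nhds
    · filter_upwards [self_mem_nhdsWithin] with t ht
      simpa using ht
  exact ht.frequently (Filter.Eventually.frequently (Filter.Eventually.of_forall hr))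

lemma torus_dense {R : ℕ} {E : (Fin R → Fin 4 → ℂ) → ℂ} (hE : Differentiable ℂ E)
    (h : ∀ θ : Fin R → Fin 4 → ℝ, E (fun j k => Complex.exp (Complex.I * (θ j k : ℂ))) = 0)
    (w : Fin R → Fin 4 → ℂ) : E w = 0 := by
  have h1 : ∀ ζ : Fin R → Fin 4 → ℂ, E (fun j k => Complex.exp (Complex.I * ζ j k)) = 0 := by
    intro ζ
    have := entire_real (h := fun z => E (fun j k =>
      Complex.exp (Complex.I * ((ζ j k).re + z * (ζ j k).im)))) ?_ ?_ Complex.I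
    · convert this using 5 with j k
      rw [mul_comm Complex.I ((ζ j k).im : ℂ)]
      exact congrArg _ (Complex.re_add_im _).symm
    · apply hE.comp
      rw [differentiable_pi]; intro j
      rw [differentiable_pi]; intro k
      fun_prop
    · intro t
      have := h (fun j k => (ζ j k).re + t * (ζ j k).im)
      push_cast at this
      exact this
  have h2 : ∀ w : Fin R → Fin 4 → ℂ, (∀ j k, w j k ≠ 0) → E w = 0 := by
    intro w hw
    have := h1 (fun j k => - Complex.I * Complex.log (w j k))
    convert this using 3 with j
    funext k
    rw [← mul_assoc, mul_neg, Complex.I_mul_I, neg_neg, one_mul, Complex.exp_log (hw j k)]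
  have hev : ∀ᶠ z : ℂ in nhdsWithin 0 {0}ᶜ, E (fun j k => w j k + z) = 0 := by
    have : ∀ᶠ z : ℂ in nhdsWithin 0 {0}ᶜ, ∀ j k, w j k + z ≠ 0 := by
      rw [Filter.eventually_all]
      intro j
      rw [Filter.eventually_all]
      intro k
      by_cases hgi : w j k = 0
      · rw [hgi]
        filter_upwards [self_mem_nhdsWithin] with z hz
        simpa using hz
      · apply Filter.Eventually.filter_mono nhdsWithin_le_nhds
        have hc : Continuous (fun z : ℂ => w j k + z) := by fun_prop
        exact hc.continuousAt.eventually_ne (by simpa using hgi)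
    filter_upwards [this] with z hz
    exact h2 _ hz
  have hcont : Continuous (fun z : ℂ => E (fun j k => w j k + z)) := by
    apply hE.continuous.comp
    fun_prop
  have ht : Filter.Tendsto (fun z : ℂ => E (fun j k => w j k + z))
      (nhdsWithin 0 {0}ᶜ) (nhds (E w)) := by
    have := (hcont.tendsto 0).mono_left (nhdsWithin_le_nhds (s := {0}ᶜ))
    simpa using this
  exact tendsto_nhds_unique (ht.congr' hev) tendsto_const_nhds |>.symm ▸ rfl

/-- The curve of gates `V diag(w) V*`. -/
noncomputable def vd (V : Matrix.unitaryGroup (Fin 4) ℂ) (w : Fin 4 → ℂ) : M4 :=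
  V.1 * Matrix.diagonal w * star V.1

lemma vd_diff (V : Matrix.unitaryGroup (Fin 4) ℂ) : Differentiable ℂ (vd V) := by
  unfold vd
  refine Differentiable.mul (Differentiable.mul (differentiable_const _) ?_) (differentiable_const _)
  exact (LinearMap.toContinuousLinearMap (Matrix.diagonalLinearMap (Fin 4) ℂ ℂ)).differentiable

lemma stepA {n R : ℕ} (A : Architecture n R) {f : NMatrix n → ℂ} (hf : Differentiable ℂ f)
    (y : Fin R → SU4)
    (h : ∀ (l : ℂ) (V : Fin R → Matrix.unitaryGroup (Fin 4) ℂ) (θ : Fin R → Fin 4 → ℝ),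
      (∀ j, ∑ k, θ j k = 0) →
      f (l • Phi A (fun j => vd (V j) (fun k => Complex.exp (Complex.I * (θ j k : ℂ))) * (y j).1) R)
        = 0)
    (M : Fin R → M4) : f (Phi A M R) = 0 := by
  have hF : Differentiable ℂ (fun X : Fin R → M4 => f (Phi A (fun j => X j * (y j).1) R)) := by
    refine hf.comp ((Phi_diff A R).comp ?_)
    rw [differentiable_pi]
    intro j
    exact (ContinuousLinearMap.proj j : (Fin R → M4) →L[ℂ] M4).differentiable.mul
      (differentiable_const _)
  set F := fun X : Fin R → M4 => f (Phi A (fun j => X j * (y j).1) R) with hFd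
  have h1 : ∀ (V : Fin R → Matrix.unitaryGroup (Fin 4) ℂ) (θ : Fin R → Fin 4 → ℝ),
      F (fun j => vd (V j) (fun k => Complex.exp (Complex.I * (θ j k : ℂ)))) = 0 := by
    intro V θ
    set m : Fin R → ℝ := fun j => (∑ k, θ j k) / 4 with hm
    obtain ⟨l, hl⟩ := Phi_smul A (fun j => Complex.exp (Complex.I * (m j : ℂ)))
      (fun j => vd (V j) (fun k => Complex.exp (Complex.I * ((θ j k - m j : ℝ) : ℂ))) * (y j).1) R
    have := h l V (fun j k => θ j k - m j) (by
      intro j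
      simp only [Finset.sum_sub_distrib, hm, Finset.sum_const, Finset.card_univ, Fintype.card_fin]
      simp
      ring)
    rw [← hl] at this
    rw [hFd]
    simp only
    convert this using 4 with j
    rw [← smul_mul_assoc]
    congr 1
    simp only [vd]
    rw [← smul_mul_assoc, ← mul_smul_comm, ← Matrix.diagonal_smul]
    congr 3
    funext k
    simp only [Pi.smul_apply, smul_eq_mul]
    rw [← Complex.exp_add]
    congr 1
    push_cast
    ring
  have h2 : ∀ (V : Fin R → Matrix.unitaryGroup (Fin 4) ℂ) (w : Fin R → Fin 4 → ℂ),
      F (fun j => vd (V j) (w j)) = 0 := by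
    intro V w
    refine torus_dense (E := fun w => F (fun j => vd (V j) (w j))) ?_ (h1 V) w
    apply hF.comp
    rw [differentiable_pi]
    intro j
    exact (vd_diff (V j)).comp
      (ContinuousLinearMap.proj j : (Fin R → Fin 4 → ℂ) →L[ℂ] (Fin 4 → ℂ)).differentiable
  have h3 : ∀ H : Fin R → M4, (∀ j, (H j).IsHermitian) → F H = 0 := by
    intro H hH
    have := h2 (fun j => (hH j).eigenvectorUnitary)
      (fun j => RCLike.ofReal ∘ (hH j).eigenvalues)
    convert this using 2
    funext j
    exact (hH j).spectral_theorem
  have h4 : ∀ X : Fin R → M4, F X = 0 := by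
    intro X
    set H1 : Fin R → M4 := fun j => (1 / 2 : ℂ) • (X j + star (X j))
    set H2 : Fin R → M4 := fun j => (-Complex.I / 2) • (X j - star (X j))
    have := entire_real (h := fun z => F (fun j => H1 j + z • H2 j)) ?_ ?_ Complex.I
    · convert this using 2
      funext j
      simp only [H1, H2, smul_smul]
      have e : Complex.I * (-Complex.I / 2) = 1 / 2 := by
        rw [mul_div_assoc', mul_neg, Complex.I_mul_I, neg_neg]
      rw [e, ← smul_add]
      ext a b
      simp
      ring
    · apply hF.comp
      rw [differentiable_pi]; intro j
      exact (differentiable_const _).add (differentiable_id.smul_const _)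
    · intro t
      apply h3
      intro j
      simp only [H1, H2]
      ext a b
      simp [Matrix.conjTranspose_apply]
      ring
  have := h4 (fun j => M j * (y j)⁻¹.1)
  simp only [hFd, mul_assoc, su_inv_val, mul_one] at this
  exact this
end Dens

/-! ## Null sets -/

lemma null_abs {G : Type*} [Group G] [TopologicalSpace G] [IsTopologicalGroup G]
    [MeasurableSpace G] [BorelSpace G] [SecondCountableTopology G] (μ : Measure G)
    [μ.IsMulLeftInvariant] [SFinite μ] (Z : Set G)
    (H : ∀ y, ∃ (g : ℝ → G) (h : ℝ × G → ℂ), Continuous g ∧ g 0 = 1 ∧ Continuous h ∧ h (1, y) ≠ 0 ∧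
      (∀ y', h (1, y') ≠ 0 → {t | h (t, y') = 0}.Countable) ∧
      ∀ t y', g t * y' ∈ Z → h (t, y') = 0) : μ Z = 0 := by
  apply measure_null_of_locally_null
  intro y _
  obtain ⟨g, h, hg, hg0, hh, hy, hc, hZ⟩ := H y
  have hc1 : Continuous (fun y' : G => h (1, y')) := by fun_prop
  set N : Set G := {y' | h (1, y') ≠ 0} with hN
  have hNo : IsOpen N := isOpen_ne_fun hc1 continuous_const
  set B : Set (ℝ × G) := {p | h (1, p.2) ≠ 0 ∧ h p = 0} with hB
  have hBm : MeasurableSet B := by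
    have h1 : MeasurableSet {p : ℝ × G | h (1, p.2) ≠ 0} :=
      (isOpen_ne_fun (hc1.comp continuous_snd) continuous_const).measurableSet
    have h2 : MeasurableSet {p : ℝ × G | h p = 0} :=
      (isClosed_eq hh continuous_const).measurableSet
    exact h1.inter h2
  have hB0 : (volume.prod μ) B = 0 := by
    rw [Measure.prod_apply_symm hBm]
    rw [lintegral_eq_zero_of_ae_eq_zero]
    refine Filter.Eventually.of_forall fun y' => ?_
    by_cases hy' : h (1, y') ≠ 0
    · exact measure_mono_null (fun t ht => ht.2) ((hc y' hy').measure_zero volume)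
    · have : (fun t : ℝ => (t, y')) ⁻¹' B = ∅ := by
        ext t; simp [hB, not_not.mp hy']
      simp [this]
  have hae := Measure.measure_ae_null_of_prod_null hB0
  have hO : IsOpen {t : ℝ | (g t)⁻¹ * y ∈ N} := hNo.preimage (by fun_prop)
  have h0 : (0 : ℝ) ∈ {t : ℝ | (g t)⁻¹ * y ∈ N} := by
    simp only [Set.mem_ofPred_eq, hg0, inv_one, one_mul]; exact hy
  obtain ⟨t, ht1, ht2⟩ : ∃ t, (g t)⁻¹ * y ∈ N ∧ μ (Prod.mk t ⁻¹' B) = 0 := by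
    by_contra hcon
    push Not at hcon
    have : {t : ℝ | (g t)⁻¹ * y ∈ N} ⊆ {t | ¬ μ (Prod.mk t ⁻¹' B) = 0} := fun t ht => hcon t ht
    have h2 := measure_mono_null this hae
    exact (hO.measure_pos volume ⟨0, h0⟩).ne' h2
  refine ⟨Z ∩ (fun y'' => (g t)⁻¹ * y'') ⁻¹' N, ?_, ?_⟩
  · refine Filter.inter_mem self_mem_nhdsWithin (mem_nhdsWithin_of_mem_nhds ?_)
    exact (hNo.preimage (continuous_const_mul _)).mem_nhds ht1
  · have : Z ∩ (fun y'' => (g t)⁻¹ * y'') ⁻¹' N ⊆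
        (fun y'' => (g t)⁻¹ * y'') ⁻¹' (Prod.mk t ⁻¹' B) := by
      rintro y'' ⟨hz, hn⟩
      exact ⟨hn, hZ t _ (by simpa using hz)⟩
    refine measure_mono_null this ?_
    rw [measure_preimage_mul]
    exact ht2

lemma entire_zeros_countable {h : ℂ → ℂ} (hd : Differentiable ℂ h) (h1 : h 1 ≠ 0) :
    {t : ℝ | h t = 0}.Countable := by
  have key : ∀ z0 : ℂ, ∀ᶠ z in nhdsWithin z0 {z0}ᶜ, h z ≠ 0 := by
    intro z0
    by_contra hcon
    exact h1 (entire_eq_zero hd (z0 := z0) (fun hc => hcon hc) 1)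
  have hdz : IsDiscrete {t : ℝ | h t = 0} := by
    rw [isDiscrete_iff_nhdsNE]
    intro x hx
    have ht : Filter.Tendsto (fun t : ℝ => (t : ℂ)) (nhdsWithin x {x}ᶜ)
        (nhdsWithin (x : ℂ) {(x : ℂ)}ᶜ) := by
      refine tendsto_nhdsWithin_iff.mpr ⟨?_, ?_⟩
      · exact (Complex.continuous_ofReal.tendsto x).mono_left nhdsWithin_le_nhds
      · filter_upwards [self_mem_nhdsWithin] with t ht
        simpa using ht
    have h2 := ht.eventually (key x)
    rw [← disjoint_iff, Filter.disjoint_principal_right]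
    filter_upwards [h2] with t ht
    exact ht
  have : DiscreteTopology {t : ℝ | h t = 0} := isDiscrete_iff_discreteTopology.mp hdz
  exact Set.countable_coe_iff.mp (countable_of_Lindelof_of_discrete)

section Dens
attribute [local instance] Matrix.linftyOpNormedRing Matrix.linftyOpNormedAlgebra

lemma vd_mem (V : Matrix.unitaryGroup (Fin 4) ℂ) (θ : Fin 4 → ℝ) (hθ : ∑ k, θ k = 0) :
    vd V (fun k => Complex.exp (Complex.I * (θ k : ℂ))) ∈ Matrix.specialUnitaryGroup (Fin 4) ℂ := by
  have hd : Matrix.diagonal (fun k => Complex.exp (Complex.I * (θ k : ℂ))) ∈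
      Matrix.unitaryGroup (Fin 4) ℂ := by
    rw [Matrix.mem_unitaryGroup_iff, Matrix.star_eq_conjTranspose, Matrix.diagonal_conjTranspose,
      Matrix.diagonal_mul_diagonal, ← Matrix.diagonal_one]
    congr 1
    funext k
    simp only [Pi.star_apply, RCLike.star_def]
    rw [← Complex.exp_conj, ← Complex.exp_add]
    simp
  rw [Matrix.mem_specialUnitaryGroup_iff]
  refine ⟨mul_mem (mul_mem V.2 hd) (Unitary.star_mem V.2), ?_⟩
  unfold vd
  rw [Matrix.det_mul_right_comm, (Matrix.mem_unitaryGroup_iff.mp V.2), one_mul, Matrix.det_diagonal,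
    ← Complex.exp_sum, ← Finset.mul_sum]
  have : ∑ k, (θ k : ℂ) = 0 := by exact_mod_cast hθ
  simp [this]

lemma null_main {n R : ℕ} (A : Architecture n R) {f : NMatrix n → ℂ} (hf : Differentiable ℂ f)
    (hM : ∃ M : Fin R → M4, f (Phi A M R) ≠ 0) :
    ∀ᵐ x ∂(muSU4 R), ∃ l : ℂ, f (l • Phi A (cl x) R) ≠ 0 := by
  have : SecondCountableTopology M4 :=
    inferInstanceAs (SecondCountableTopology (Fin 4 → Fin 4 → ℂ))
  have : SecondCountableTopology SU4 := TopologicalSpace.Subtype.secondCountableTopology _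
  have : (muSU4 R).IsMulLeftInvariant := by unfold muSU4 haarSU4; infer_instance
  have : IsProbabilityMeasure (muSU4 R) := by unfold muSU4; infer_instance
  rw [ae_iff]
  apply null_abs
  intro y
  obtain ⟨M, hM⟩ := hM
  have hA := mt (fun h => stepA A hf y h M) hM
  push Not at hA
  obtain ⟨l, V, θ, hθ, hne⟩ := hA
  have hcz : ∀ j, Differentiable ℂ (fun z : ℂ =>
      vd (V j) (fun k => Complex.exp (Complex.I * (z * (θ j k : ℂ))))) := by
    intro j
    refine (vd_diff (V j)).comp ?_
    rw [differentiable_pi]; intro k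
    fun_prop
  have hFd : Differentiable ℂ (fun X : Fin R → M4 => f (l • Phi A X R)) :=
    hf.comp ((Phi_diff A R).const_smul l)
  refine ⟨fun t j => ⟨vd (V j) (fun k => Complex.exp (Complex.I * ((t * θ j k : ℝ) : ℂ))),
    vd_mem (V j) (fun k => t * θ j k) (by rw [← Finset.mul_sum, hθ j, mul_zero])⟩,
    fun p => f (l • Phi A (fun j =>
      vd (V j) (fun k => Complex.exp (Complex.I * ((p.1 * θ j k : ℝ) : ℂ))) * (p.2 j).1) R),
    ?_, ?_, ?_, ?_, ?_, ?_⟩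
  · refine continuous_pi fun j => Continuous.subtype_mk ?_ _
    have := (hcz j).continuous.comp Complex.continuous_ofReal
    simp only [Function.comp_def] at this
    push_cast
    exact this
  · funext j
    apply Subtype.ext
    simp [vd]
  · refine hFd.continuous.comp (continuous_pi fun j => ?_)
    have := ((hcz j).continuous.comp Complex.continuous_ofReal).comp
      (continuous_fst (X := ℝ) (Y := Fin R → SU4))
    simp only [Function.comp_def] at this
    push_cast
    exact Continuous.matrix_mul this
      (continuous_subtype_val.comp ((continuous_apply j).comp continuous_snd))
  · simpa using hne
  · intro y' hy'
    have hdd : Differentiable ℂ (fun z : ℂ => f (l • Phi A (fun j =>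
      vd (V j) (fun k => Complex.exp (Complex.I * (z * (θ j k : ℂ)))) * (y' j).1) R)) := by
      refine hFd.comp ?_
      rw [differentiable_pi]; intro j
      exact (hcz j).mul (differentiable_const _)
    have := entire_zeros_countable hdd (by simpa using hy')
    push_cast
    exact this
  · intro t y' hz
    simp only [Set.mem_ofPred_eq, not_exists, not_not] at hz
    exact hz l
end Dens

/-! ## Final assembly -/

lemma contract_eq {n R : ℕ} (A : Architecture n R) (x : Fin R → SU4) :
    contract A x = Phi A (cl x) R := by
  have key : ∀ k ≤ R, ((gateList A x).take k).reverse.prod = Phi A (cl x) k := by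
    intro k
    induction k with
    | zero => intro _; simp [Phi]
    | succ k ih =>
      intro hk
      have hlen : k < (gateList A x).length := by simp [gateList]; omega
      rw [List.take_add_one, List.getElem?_eq_getElem hlen]
      simp only [Option.toList_some, List.reverse_append, List.reverse_cons, List.reverse_nil,
        List.nil_append, List.prod_append, List.prod_singleton, Phi]
      rw [ih (by omega), GG, dif_pos (show k < R by omega)]
      simp [gateList, cl]
  have := key R le_rfl
  rw [List.take_of_length_le (by simp [gateList])] at this
  exact this

lemma ae_not_mem {n R R' d : ℕ} (A : Architecture n R) (A' : Architecture n R') (x0 : Fin R → SU4)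
    (hR : R ≠ 0) (hd : d ≤ Module.finrank ℂ (Sv A x0 R)) (hd2 : 9 * R' + 3 * n + 1 < d) :
    ∀ᵐ x ∂(muSU4 R), ∀ x' : Fin R' → SU4, contract A' x' ≠ contract A x := by
  obtain ⟨l, hl⟩ := exists_proj A x0 hR d hd
  obtain ⟨P, hP, hv⟩ := exists_relation A' hd2 l
  filter_upwards [null_main A (eval_diff l P) (hl P hP)] with x hx x' he
  obtain ⟨c, hc⟩ := hx
  rw [contract_eq, contract_eq] at he
  rw [← he] at hc
  exact hc (hv c _)

/-- **Linear growth of circuit complexity** (Haferkamp–Faist–Kothakonda–Eisert–Yunger Halpern).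
Let `A` be an `n`-qubit architecture with `R = T·L` gates that is the concatenation of `T`
consecutive causal slices of `L` gates each, with `T ≤ 4^n − 1`.  Then, with unit probability
over the choice of Haar-random gates `x ∈ SU(4)^{×R}`, the exact circuit complexity of the
implemented unitary is at least `R/(9L) − n/3`. -/
theorem linear_growth_of_circuit_complexity
    (n T L : ℕ) (hn : 2 ≤ n) (hT : T ≤ 4 ^ n - 1)
    (A : Architecture n (T * L))
    (hslices : ∀ s < T, IsCausalSlice A (s * L) ((s + 1) * L)) :
    ∀ᵐ x ∂(muSU4 (T * L)),
      ((T * L : ℕ) : ℝ) / (9 * (L : ℝ)) - (n : ℝ) / 3 ≤ (Cu n (contract A x) : ℝ) := by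
  rcases Nat.eq_zero_or_pos (T * L) with h0 | hpos
  · refine Filter.Eventually.of_forall fun x => ?_
    have h1 : (0 : ℝ) ≤ (Cu n (contract A x) : ℝ) := Nat.cast_nonneg _
    have h2 : (0 : ℝ) ≤ (n : ℝ) := Nat.cast_nonneg _
    have h3 : ((T * L : ℕ) : ℝ) = 0 := by exact_mod_cast h0
    have h4 : ((T * L : ℕ) : ℝ) / (9 * (L : ℝ)) = 0 := by rw [h3, zero_div]
    linarith
  have hL : 0 < L := Nat.pos_of_mul_pos_left hpos
  obtain ⟨x0, hx0⟩ := rank_grow n T L hn hT A hslices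
  have hall : ∀ᵐ x ∂(muSU4 (T * L)), ∀ R' : ℕ, ∀ A' : Architecture n R', 9 * R' + 3 * n < T →
      ∀ x' : Fin R' → SU4, contract A' x' ≠ contract A x := by
    rw [ae_all_iff]
    intro R'
    haveI : Finite (Architecture n R') :=
      inferInstanceAs (Finite (Fin R' → {p : Fin n × Fin n // p.1 ≠ p.2}))
    rw [ae_all_iff]
    intro A'
    by_cases h : 9 * R' + 3 * n < T
    · filter_upwards [ae_not_mem A A' x0 hpos.ne' hx0 (by omega)] with x hx _
      exact hx
    · exact Filter.Eventually.of_forall fun x h' => absurd h' h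
  filter_upwards [hall] with x hx
  have hmem : Cu n (contract A x) ∈
      {R | ∃ A' : Architecture n R, ∃ x' : Fin R → SU4, contract A' x' = contract A x} :=
    Nat.sInf_mem ⟨T * L, A, x, rfl⟩
  obtain ⟨A', x', he⟩ := hmem
  have hle : T ≤ 9 * Cu n (contract A x) + 3 * n := by
    by_contra hcon
    exact hx _ A' (by omega) x' he
  have hle' : (T : ℝ) ≤ 9 * (Cu n (contract A x) : ℝ) + 3 * n := by exact_mod_cast hle
  have hL' : (L : ℝ) ≠ 0 := by exact_mod_cast hL.ne'
  have he2 : ((T * L : ℕ) : ℝ) / (9 * (L : ℝ)) = T / 9 := by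
    push_cast
    field_simp
  rw [he2]
  linarith
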